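/- Let p, q ∈ [2, ∞) with q < p. There exists C = C(p) ∈ (0, ∞) depending only on p such that the following holds. Let θ ∈ (0, 1], L ∈ [1, ∞), and suppose ψ : L_q → L_p satisfies ‖x − y‖_{L_q}^θ ≤ ‖ψ(x) − ψ(y)‖_{L_p} ≤ L·‖x − y‖_{L_q}^θ for all x, y ∈ L_q. Then for every n ∈ ℕ and every k ∈ [n], 1 ≤ C · L · n^{(1−θ)/2} · ( k + k^{p/2} n^{p(θ/q − 1/2)} )^{1/p} · k^{θ(1/2 − 1/q) − 1/2}. -/

import Mathlib

/-- The Lebesgue space `L_p(ℝ)` (with `p ∈ [1,∞)` given as a real number). -/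
noncomputable abbrev LpSpace (p : ℝ) :=
  MeasureTheory.Lp ℝ (ENNReal.ofReal p) (MeasureTheory.volume : MeasureTheory.Measure ℝ)

open Finset

/-- The product weight on `ι → α` attached to a weight `w` on `α`. -/
def prodWeight {ι α : Type*} [Fintype ι] (w : α → ℝ) (x : ι → α) : ℝ := ∏ i, w (x i)

lemma prodWeight_nonneg {ι α : Type*} [Fintype ι] {w : α → ℝ} (hw : ∀ a, 0 ≤ w a) (x : ι → α) :
    0 ≤ prodWeight w x :=
  Finset.prod_nonneg fun _ _ => hw _

lemma sum_prod_eq_prod_sum {ι α : Type*} [Fintype ι] [DecidableEq ι] [Fintype α]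
    (h : ι → α → ℝ) : ∑ x : ι → α, ∏ i, h i (x i) = ∏ i, ∑ a, h i a := by
  rw [Finset.prod_univ_sum, Fintype.piFinset_univ]

lemma sum_prodWeight {ι α : Type*} [Fintype ι] [DecidableEq ι] [Fintype α] {w : α → ℝ}
    (h1 : ∑ a, w a = 1) : ∑ x : ι → α, prodWeight w x = 1 := by
  simp only [prodWeight]
  rw [sum_prod_eq_prod_sum fun _ => w]
  simp [h1]

/-- Integrating a function of one coordinate against a product weight. -/
lemma sum_prodWeight_mul_apply {ι α : Type*} [Fintype ι] [DecidableEq ι] [Fintype α]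
    {w : α → ℝ} (h1 : ∑ a, w a = 1) (j : ι) (h : α → ℝ) :
    ∑ x : ι → α, prodWeight w x * h (x j) = ∑ a, w a * h a := by
  have key : ∀ x : ι → α, prodWeight w x * h (x j)
      = ∏ i, (fun (i : ι) (a : α) => w a * (if i = j then h a else 1)) i (x i) := by
    intro x
    simp only [prodWeight, Finset.prod_mul_distrib]
    simp
  rw [Finset.sum_congr rfl fun x _ => key x,
    sum_prod_eq_prod_sum (fun (i : ι) (a : α) => w a * (if i = j then h a else 1)),
    ← Finset.mul_prod_erase _ _ (mem_univ j)]
  rw [Finset.prod_eq_one]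
  · simp
  · intro i hi
    simp [Finset.ne_of_mem_erase hi, h1]

lemma sum_prodWeight_mul_apply_mul_apply {ι α : Type*} [Fintype ι] [DecidableEq ι] [Fintype α]
    {w : α → ℝ} {o : α → ℝ} (h0 : ∑ a, w a * o a = 0) {i j : ι} (hij : i ≠ j) :
    ∑ x : ι → α, prodWeight w x * (o (x i) * o (x j)) = 0 := by
  have key : ∀ x : ι → α, prodWeight w x * (o (x i) * o (x j))
      = ∏ l, (fun (l : ι) (a : α) =>
          w a * ((if l = i then o a else 1) * (if l = j then o a else 1))) l (x l) := by
    intro x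
    simp only [prodWeight, Finset.prod_mul_distrib]
    simp
  rw [Finset.sum_congr rfl fun x _ => key x, sum_prod_eq_prod_sum (fun (l : ι) (a : α) =>
    w a * ((if l = i then o a else 1) * (if l = j then o a else 1)))]
  refine Finset.prod_eq_zero (mem_univ i) ?_
  simp [hij, h0]

/-- A mean-zero function of one coordinate is orthogonal to functions of the others. -/
lemma sum_prodWeight_mul_update {ι α : Type*} [Fintype ι] [DecidableEq ι] [Fintype α]
    {w : α → ℝ} {o : α → ℝ} (h0 : ∑ a, w a * o a = 0) (j : ι) (b : α) (H : (ι → α) → ℝ) :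
    ∑ x : ι → α, prodWeight w x * (o (x j) * H (Function.update x j b)) = 0 := by
  let e := (Equiv.funSplitAt j α).symm
  rw [← e.sum_comp, Fintype.sum_prod_type, Finset.sum_comm]
  refine Finset.sum_eq_zero fun y _ => ?_
  have hj : ∀ a, e (a, y) j = a := by
    intro a; simp [e, Equiv.funSplitAt, Equiv.piSplitAt]
  have hne : ∀ a (i : ι), i ≠ j → e (a, y) i = e (b, y) i := by
    intro a i hi; simp [e, Equiv.funSplitAt, Equiv.piSplitAt, hi]
  have hup : ∀ a, Function.update (e (a, y)) j b = e (b, y) := by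
    intro a; ext i
    by_cases hi : i = j
    · subst hi; simp [hj]
    · simp [Function.update_of_ne hi, hne a i hi]
  have hw : ∀ a, prodWeight w (e (a, y)) = w a * ∏ i ∈ univ.erase j, w (e (b, y) i) := by
    intro a
    rw [prodWeight, ← Finset.mul_prod_erase _ _ (mem_univ j), hj]
    congr 1
    exact Finset.prod_congr rfl fun i hi => by rw [hne a i (Finset.ne_of_mem_erase hi)]
  calc ∑ a, prodWeight w (e (a, y)) * (o (e (a, y) j) * H (Function.update (e (a, y)) j b))
      = ∑ a, (w a * o a) * ((∏ i ∈ univ.erase j, w (e (b, y) i)) * H (e (b, y))) := by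
        refine Finset.sum_congr rfl fun a _ => ?_
        rw [hj, hup, hw]; ring
    _ = 0 := by rw [← Finset.sum_mul, h0, zero_mul]

/-- Jensen's inequality for `|·| ^ p`. -/
lemma abs_sum_mul_rpow_le {Ω : Type*} [Fintype Ω] {W : Ω → ℝ} (hW : ∀ a, 0 ≤ W a)
    (h1 : ∑ a, W a = 1) (z : Ω → ℝ) {p : ℝ} (hp : 1 ≤ p) :
    |∑ a, W a * z a| ^ p ≤ ∑ a, W a * |z a| ^ p := by
  have h2 : |∑ a, W a * z a| ≤ ∑ a, W a * |z a| := by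
    refine (Finset.abs_sum_le_sum_abs _ _).trans_eq ?_
    simp [abs_mul, abs_of_nonneg (hW _)]
  exact (Real.rpow_le_rpow (abs_nonneg _) h2 (by linarith)).trans
    (Real.rpow_arith_mean_le_arith_mean_rpow _ _ _ (fun i _ => hW i) h1
      (fun i _ => abs_nonneg _) hp)

lemma abs_add_rpow_le {p : ℝ} (hp : 1 ≤ p) (x y : ℝ) :
    |x + y| ^ p ≤ 2 ^ p * (|x| ^ p + |y| ^ p) := by
  have hp0 : 0 ≤ p := by linarith
  have h : ∀ a b : ℝ, |a| ≤ |b| → |a + b| ^ p ≤ 2 ^ p * |b| ^ p := by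
    intro a b hab
    rw [← Real.mul_rpow (by norm_num) (abs_nonneg b)]
    exact Real.rpow_le_rpow (abs_nonneg _) (by linarith [abs_add_le a b]) hp0
  have hx : 0 ≤ (2:ℝ) ^ p * |x| ^ p := by positivity
  have hy : 0 ≤ (2:ℝ) ^ p * |y| ^ p := by positivity
  rcases le_total |x| |y| with hxy | hxy
  · linarith [h x y hxy]
  · have := h y x hxy
    rw [add_comm y x] at this
    linarith

/-- A two-point inequality: the uniform smoothness of `|·| ^ p` on the line. -/
lemma exists_two_point {p : ℝ} (hp : 2 ≤ p) : ∃ C : ℝ, 0 < C ∧ ∀ x a : ℝ,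
    (|x + a| ^ p + |x - a| ^ p) / 2 ≤ |x| ^ p + C * (|x| ^ (p - 2) * a ^ 2 + |a| ^ p) := by
  set y0 : ℝ := p ^ 2 / 2 with hy0
  have hy0p : 0 < y0 := by positivity
  refine ⟨y0 * Real.exp y0 + 2 ^ p, by positivity, fun x a => ?_⟩
  have hp0 : 0 ≤ p := by linarith
  have hxa : 0 ≤ |x| ^ (p - 2) * a ^ 2 := by positivity
  have ha : 0 ≤ |a| ^ p := by positivity
  have hx : 0 ≤ |x| ^ p := by positivity
  have hE : 0 < y0 * Real.exp y0 := by positivity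
  have h2 : (0:ℝ) < 2 ^ p := by positivity
  rcases le_or_gt |x| |a| with h | h
  · have h1 : |x + a| ^ p ≤ 2 ^ p * |a| ^ p := by
      rw [← Real.mul_rpow (by norm_num) (abs_nonneg a)]
      exact Real.rpow_le_rpow (abs_nonneg _) (by linarith [abs_add_le x a]) hp0
    have h1' : |x - a| ^ p ≤ 2 ^ p * |a| ^ p := by
      rw [← Real.mul_rpow (by norm_num) (abs_nonneg a)]
      exact Real.rpow_le_rpow (abs_nonneg _) (by linarith [abs_sub x a]) hp0
    nlinarith [mul_nonneg hE.le hxa, mul_nonneg hE.le ha, mul_nonneg h2.le hxa]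
  · have hx0 : x ≠ 0 := by
      rintro rfl
      simp at h
      linarith [abs_nonneg a]
    set t := a / x with ht
    have hat : a = x * t := by rw [ht]; field_simp
    have ht1 : |t| ≤ 1 := by
      rw [ht, abs_div]; exact (div_le_one (abs_pos.2 hx0)).2 h.le
    have ht2 := abs_le.1 ht1
    have e1 : |x + a| = |x| * (1 + t) := by
      rw [hat, show x + x * t = x * (1 + t) by ring, abs_mul, abs_of_nonneg (by linarith : 0 ≤ 1 + t)]
    have e2 : |x - a| = |x| * (1 - t) := by
      rw [hat, show x - x * t = x * (1 - t) by ring, abs_mul, abs_of_nonneg (by linarith : 0 ≤ 1 - t)]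
    have b1 : (1 + t) ^ p ≤ Real.exp (p * t) := by
      rw [mul_comm, Real.exp_mul]
      exact Real.rpow_le_rpow (by linarith) (by linarith [Real.add_one_le_exp t]) hp0
    have b2 : (1 - t) ^ p ≤ Real.exp (-(p * t)) := by
      rw [show -(p * t) = (-t) * p by ring, Real.exp_mul]
      exact Real.rpow_le_rpow (by linarith) (by linarith [Real.add_one_le_exp (-t)]) hp0
    have htsq : t ^ 2 ≤ 1 := by nlinarith [abs_nonneg t, sq_abs t]
    have b3 : Real.exp ((p * t) ^ 2 / 2) ≤ 1 + y0 * Real.exp y0 * t ^ 2 := by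
      set y := (p * t) ^ 2 / 2 with hy
      have hyy : y = y0 * t ^ 2 := by rw [hy, hy0]; ring
      have hy1 : y ≤ y0 := by rw [hyy]; nlinarith
      have hyn : 0 ≤ y := by positivity
      have := Real.one_sub_le_exp_neg y
      have h3 : Real.exp y - 1 ≤ y * Real.exp y := by
        have hm : Real.exp y * Real.exp (-y) = 1 := by rw [← Real.exp_add]; simp
        nlinarith [Real.exp_pos y]
      have h4 : y * Real.exp y ≤ y * Real.exp y0 :=
        mul_le_mul_of_nonneg_left (Real.exp_le_exp.2 hy1) hyn
      rw [hyy] at h4 h3 ⊢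
      nlinarith
    have b4 : ((1 + t) ^ p + (1 - t) ^ p) / 2 ≤ 1 + y0 * Real.exp y0 * t ^ 2 := by
      refine le_trans ?_ b3
      refine le_trans ?_ (Real.cosh_le_exp_half_sq _)
      rw [Real.cosh_eq]; linarith
    have e3 : |x| ^ p * t ^ 2 = |x| ^ (p - 2) * a ^ 2 := by
      have : |x| ^ p = |x| ^ (p - 2) * |x| ^ (2:ℝ) := by
        rw [← Real.rpow_add (abs_pos.2 hx0)]; ring_nf
      rw [this, hat, Real.rpow_two, sq_abs]; ring
    rw [e1, e2, Real.mul_rpow (abs_nonneg _) (by linarith), Real.mul_rpow (abs_nonneg _) (by linarith)]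
    have b5 := mul_le_mul_of_nonneg_left b4 hx
    have : |x| ^ p * (1 + y0 * Real.exp y0 * t ^ 2)
        = |x| ^ p + y0 * Real.exp y0 * (|x| ^ (p - 2) * a ^ 2) := by rw [← e3]; ring
    nlinarith [mul_nonneg hE.le ha, mul_nonneg h2.le ha, mul_nonneg h2.le hxa]

lemma abs_rpow_le_two_point {p : ℝ} (hp : 1 ≤ p) (x a : ℝ) :
    |x| ^ p ≤ (|x + a| ^ p + |x - a| ^ p) / 2 := by
  have := abs_sum_mul_rpow_le (Ω := Bool) (W := fun _ => 1 / 2) (fun _ => by norm_num)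
    (by simp) (fun b => if b then x + a else x - a) hp
  simp only [Fintype.sum_bool, if_true, Bool.false_eq_true, if_false] at this
  rw [show 1 / 2 * (x + a) + 1 / 2 * (x - a) = x by ring] at this
  linarith

lemma le_of_le_mul_rpow_add {p : ℝ} (hp : 2 < p) {A α β : ℝ} (hA : 0 ≤ A) (hα : 0 ≤ α)
    (hβ : 0 ≤ β) (h : A ≤ α * A ^ (1 - 2 / p) + β) : A ≤ (2 * α) ^ (p / 2) + 2 * β := by
  have hp0 : 0 < p := by linarith
  have hn : 0 ≤ (2 * α) ^ (p / 2) := by positivity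
  rcases hA.eq_or_lt with rfl | hA
  · linarith
  rcases le_or_gt (α * A ^ (1 - 2 / p)) (A / 2) with h1 | h1
  · linarith
  · have h2 : A ^ (2 / p) ≤ 2 * α := by
      have h3 : A = A ^ (2 / p) * A ^ (1 - 2 / p) := by
        rw [← Real.rpow_add hA]; simp
      have h4 : 0 < A ^ (1 - 2 / p) := by positivity
      by_contra! hc
      nlinarith
    have h5 : (A ^ (2 / p)) ^ (p / 2) ≤ (2 * α) ^ (p / 2) :=
      Real.rpow_le_rpow (by positivity) h2 (by positivity)
    rw [← Real.rpow_mul hA.le, show 2 / p * (p / 2) = 1 by field_simp, Real.rpow_one] at h5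
    linarith

/-- The law of a random sign that vanishes with probability `1 - δ`. -/
noncomputable def signWeight (δ : ℝ) (s : SignType) : ℝ := if s = 0 then 1 - δ else δ / 2

lemma signWeight_nonneg {δ : ℝ} (h0 : 0 ≤ δ) (h1 : δ ≤ 1) (s : SignType) :
    0 ≤ signWeight δ s := by
  unfold signWeight; split_ifs <;> linarith

lemma sum_signWeight_mul (δ : ℝ) (h : SignType → ℝ) :
    ∑ s, signWeight δ s * h s = (1 - δ) * h 0 + δ * ((h 1 + h (-1)) / 2) := by
  rw [SignType.univ_eq]
  simp [signWeight]; ring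

lemma sum_signWeight (δ : ℝ) : ∑ s, signWeight δ s = 1 := by
  have := sum_signWeight_mul δ fun _ => 1
  simp only [mul_one] at this
  rw [this]; ring

/-- Rosenthal's inequality for weighted sums of independent lacunary signs. -/
lemma exists_rosenthal {p : ℝ} (hp : 2 < p) : ∃ C : ℝ, 0 < C ∧ ∀ δ : ℝ, 0 ≤ δ → δ ≤ 1 →
    ∀ (n : ℕ) (a : Fin n → ℝ),
    ∑ ξ : Fin n → SignType, prodWeight (signWeight δ) ξ * |∑ j, (ξ j : ℝ) * a j| ^ p
      ≤ C * (δ * ∑ j, |a j| ^ p + (δ * ∑ j, a j ^ 2) ^ (p / 2)) := by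
  obtain ⟨C, hC, h2⟩ := exists_two_point hp.le
  have hp0 : 0 < p := by linarith
  have main : ∀ δ : ℝ, 0 ≤ δ → δ ≤ 1 → ∀ (n : ℕ) (a : Fin n → ℝ),
      ∑ ξ : Fin n → SignType, prodWeight (signWeight δ) ξ * |∑ j, (ξ j : ℝ) * a j| ^ p
      ≤ C * δ * (∑ j, a j ^ 2) *
        (∑ ξ : Fin n → SignType, prodWeight (signWeight δ) ξ * |∑ j, (ξ j : ℝ) * a j| ^ p)
          ^ (1 - 2 / p) + C * δ * ∑ j, |a j| ^ p := by
    intro δ h0 h1 n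
    induction n with
    | zero =>
      intro a
      simp [Real.zero_rpow hp0.ne']
    | succ n ih =>
      intro a
      set b : Fin n → ℝ := fun j => a j.succ with hb
      set X : (Fin n → SignType) → ℝ := fun ξ => ∑ j, (ξ j : ℝ) * b j with hX
      set W : (Fin n → SignType) → ℝ := prodWeight (signWeight δ) with hWdef
      have hW : ∀ ξ, 0 ≤ W ξ := prodWeight_nonneg (signWeight_nonneg h0 h1)
      have hW1 : ∑ ξ, W ξ = 1 := sum_prodWeight (sum_signWeight δ)
      set A := ∑ ξ, W ξ * |X ξ| ^ p with hA
      have hA0 : 0 ≤ A := Finset.sum_nonneg fun ξ _ => mul_nonneg (hW ξ) (by positivity)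
      have split : ∑ ξ : Fin (n + 1) → SignType,
          prodWeight (signWeight δ) ξ * |∑ j, (ξ j : ℝ) * a j| ^ p
          = ∑ ξ, W ξ * ((1 - δ) * |X ξ| ^ p
            + δ * ((|X ξ + a 0| ^ p + |X ξ - a 0| ^ p) / 2)) := by
        rw [← (Fin.consEquiv fun _ => SignType).sum_comp, Fintype.sum_prod_type, Finset.sum_comm]
        refine Finset.sum_congr rfl fun ξ _ => ?_
        have := sum_signWeight_mul δ fun s => W ξ * |(s : ℝ) * a 0 + X ξ| ^ p
        simp only [Fin.consEquiv, Equiv.coe_fn_mk, prodWeight, Fin.prod_univ_succ,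
          Fin.sum_univ_succ, Fin.cons_zero, Fin.cons_succ]
        simp only [hX, hWdef, prodWeight, hb] at this ⊢
        rw [Finset.sum_congr rfl fun s _ => mul_assoc _ _ _, this]
        simp only [SignType.coe_zero, SignType.coe_one, SignType.coe_neg, zero_mul, zero_add, one_mul,
          neg_mul]
        rw [add_comm (a 0), neg_add_eq_sub]
        ring
      set A' := ∑ ξ : Fin (n + 1) → SignType,
          prodWeight (signWeight δ) ξ * |∑ j, (ξ j : ℝ) * a j| ^ p with hA'
      have mono : A ≤ A' := by
        rw [split]
        refine Finset.sum_le_sum fun ξ _ => mul_le_mul_of_nonneg_left ?_ (hW ξ)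
        nlinarith [abs_rpow_le_two_point (by linarith : 1 ≤ p) (X ξ) (a 0)]
      have step : A' ≤ A + C * δ * (a 0 ^ 2 * (∑ ξ, W ξ * |X ξ| ^ (p - 2)) + |a 0| ^ p) := by
        have : A + C * δ * (a 0 ^ 2 * (∑ ξ, W ξ * |X ξ| ^ (p - 2)) + |a 0| ^ p)
            = ∑ ξ, W ξ * (|X ξ| ^ p
              + C * δ * (|X ξ| ^ (p - 2) * a 0 ^ 2 + |a 0| ^ p)) := by
          have e : ∀ ξ, W ξ * (|X ξ| ^ p + C * δ * (|X ξ| ^ (p - 2) * a 0 ^ 2 + |a 0| ^ p))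
              = W ξ * |X ξ| ^ p + C * δ * a 0 ^ 2 * (W ξ * |X ξ| ^ (p - 2))
                + C * δ * |a 0| ^ p * W ξ := fun ξ => by ring
          rw [Finset.sum_congr rfl fun ξ _ => e ξ, Finset.sum_add_distrib,
            Finset.sum_add_distrib, ← Finset.mul_sum, ← Finset.mul_sum, hW1]
          ring
        rw [split, this]
        refine Finset.sum_le_sum fun ξ _ => mul_le_mul_of_nonneg_left ?_ (hW ξ)
        nlinarith [h2 (X ξ) (a 0)]
      have jens : ∑ ξ, W ξ * |X ξ| ^ (p - 2) ≤ A ^ (1 - 2 / p) := by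
        have hq : 1 ≤ p / (p - 2) := by rw [le_div_iff₀] <;> linarith
        have h3 := Real.rpow_arith_mean_le_arith_mean_rpow univ W (fun ξ => |X ξ| ^ (p - 2))
          (fun ξ _ => hW ξ) hW1 (fun ξ _ => by positivity) hq
        have h4 : ∀ ξ, (|X ξ| ^ (p - 2)) ^ (p / (p - 2)) = |X ξ| ^ p := by
          intro ξ
          rw [← Real.rpow_mul (abs_nonneg _)]
          congr 1
          have : p - 2 ≠ 0 := by linarith
          field_simp
        simp only [h4] at h3
        have h5 : 0 ≤ ∑ ξ, W ξ * |X ξ| ^ (p - 2) :=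
          Finset.sum_nonneg fun ξ _ => mul_nonneg (hW ξ) (by positivity)
        have h6 := Real.rpow_le_rpow (by positivity) h3
          (show 0 ≤ 1 - 2 / p by rw [sub_nonneg, div_le_one hp0]; exact hp.le)
        rw [← Real.rpow_mul h5, show p / (p - 2) * (1 - 2 / p) = 1 by
          have : p - 2 ≠ 0 := by linarith
          field_simp, Real.rpow_one] at h6
        exact h6
      have hmono : A ^ (1 - 2 / p) ≤ A' ^ (1 - 2 / p) :=
        Real.rpow_le_rpow hA0 mono (by rw [sub_nonneg, div_le_one hp0]; exact hp.le)
      rw [Fin.sum_univ_succ, Fin.sum_univ_succ]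
      have ih' := ih b
      have hCδ : 0 ≤ C * δ := by positivity
      have hS : 0 ≤ ∑ j, b j ^ 2 := Finset.sum_nonneg fun _ _ => sq_nonneg _
      have k1 := mul_le_mul_of_nonneg_left hmono (mul_nonneg hCδ hS)
      have k2 := mul_le_mul_of_nonneg_left (jens.trans hmono) (mul_nonneg hCδ (sq_nonneg (a 0)))
      have ih2 : A ≤ C * δ * (∑ j, b j ^ 2) * A ^ (1 - 2 / p) + C * δ * ∑ j, |b j| ^ p := ih'
      calc A' ≤ _ := step
        _ ≤ C * δ * (a 0 ^ 2 + ∑ j, b j ^ 2) * A' ^ (1 - 2 / p)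
            + C * δ * (|a 0| ^ p + ∑ j, |b j| ^ p) := by linarith
  refine ⟨(2 * C) ^ (p / 2) + 2 * C, by positivity, fun δ h0 h1 n a => ?_⟩
  have hS : 0 ≤ ∑ j, a j ^ 2 := Finset.sum_nonneg fun _ _ => sq_nonneg _
  have hP : 0 ≤ ∑ j, |a j| ^ p := Finset.sum_nonneg fun _ _ => by positivity
  have h3 := le_of_le_mul_rpow_add hp
    (Finset.sum_nonneg fun ξ _ => mul_nonneg (prodWeight_nonneg (signWeight_nonneg h0 h1) ξ)
      (by positivity)) (by positivity) (by positivity) (main δ h0 h1 n a)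
  refine h3.trans ?_
  rw [show 2 * (C * δ * ∑ j, a j ^ 2) = (2 * C) * (δ * ∑ j, a j ^ 2) by ring,
    Real.mul_rpow (by positivity) (by positivity)]
  have e1 : 0 ≤ (2 * C) ^ (p / 2) * (δ * ∑ j, |a j| ^ p) := by positivity
  have e2 : 0 ≤ 2 * C * (δ * ∑ j, a j ^ 2) ^ (p / 2) := by positivity
  nlinarith

lemma abs_prod_one_add_sub_le {ι : Type*} (s : Finset ι) {r : ι → ℝ} {κ : ℝ}
    (hκ : κ ≤ 1) (hr : ∀ i, |r i| ≤ κ) :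
    |∏ i ∈ s, (1 + r i) - 1 - ∑ i ∈ s, r i| ≤ κ ^ 2 * 2 ^ s.card := by
  classical
  rcases s.eq_empty_or_nonempty with rfl | ⟨i, -⟩
  · simpa using sq_nonneg κ
  have hκ0 : 0 ≤ κ := (abs_nonneg _).trans (hr i)
  suffices h : |∏ i ∈ s, (1 + r i)| ≤ 2 ^ s.card ∧
      |∏ i ∈ s, (1 + r i) - 1| ≤ κ * 2 ^ s.card ∧
      |∏ i ∈ s, (1 + r i) - 1 - ∑ i ∈ s, r i| ≤ κ ^ 2 * 2 ^ s.card from h.2.2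
  induction s using Finset.induction_on with
  | empty => exact ⟨by simp, by simpa using hκ0, by simpa using sq_nonneg κ⟩
  | insert a s ha ih =>
    obtain ⟨h1, h2, h3⟩ := ih
    rw [Finset.prod_insert ha, Finset.sum_insert ha, Finset.card_insert_of_notMem ha, pow_succ]
    set P := ∏ i ∈ s, (1 + r i)
    set S := ∑ i ∈ s, r i
    have hP : (0:ℝ) ≤ 2 ^ s.card := by positivity
    have h4 : |r a * P| ≤ κ * 2 ^ s.card := by
      rw [abs_mul]; exact mul_le_mul (hr a) h1 (abs_nonneg _) hκ0
    have h5 : |r a * (P - 1)| ≤ κ * (κ * 2 ^ s.card) := by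
      rw [abs_mul]; exact mul_le_mul (hr a) h2 (abs_nonneg _) hκ0
    have h6 : κ * 2 ^ s.card ≤ 2 ^ s.card := by nlinarith
    refine ⟨?_, ?_, ?_⟩
    · rw [show (1 + r a) * P = P + r a * P by ring]
      linarith [abs_add_le P (r a * P)]
    · rw [show (1 + r a) * P - 1 = (P - 1) + r a * P by ring]
      linarith [abs_add_le (P - 1) (r a * P)]
    · rw [show (1 + r a) * P - 1 - (r a + S) = (P - 1 - S) + r a * (P - 1) by ring]
      linarith [abs_add_le (P - 1 - S) (r a * (P - 1))]

/-- Bessel's inequality for independent mean-zero functions bounded by `c`. -/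
lemma sum_sq_le_of_bounded {ι α : Type*} [Fintype ι] [DecidableEq ι] [Fintype α]
    {w o : α → ℝ} {c : ℝ} (hw : ∀ a, 0 ≤ w a) (h1 : ∑ a, w a = 1)
    (h0 : ∑ a, w a * o a = 0) (ho : ∀ a, |o a| ≤ c) (f : (ι → α) → ℝ) :
    ∑ j, (∑ u : ι → α, prodWeight w u * (o (u j) * f u)) ^ 2
      ≤ c ^ 2 * ∑ u : ι → α, prodWeight w u * f u ^ 2 := by
  set A : ι → ℝ := fun j => ∑ u : ι → α, prodWeight w u * (o (u j) * f u) with hA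
  set Q := ∑ j, A j ^ 2 with hQ
  set E := ∑ u : ι → α, prodWeight w u * f u ^ 2 with hE
  have hW : ∀ u : ι → α, 0 ≤ prodWeight w u := prodWeight_nonneg hw
  have hE0 : 0 ≤ E := Finset.sum_nonneg fun u _ => mul_nonneg (hW u) (sq_nonneg _)
  have hQ0 : 0 ≤ Q := Finset.sum_nonneg fun u _ => sq_nonneg _
  set S : (ι → α) → ℝ := fun u => ∑ j, A j * o (u j) with hS
  have e1 : Q = ∑ u, prodWeight w u * (S u * f u) := by
    simp only [hQ, hS, sq]
    calc ∑ j, A j * A j = ∑ j, ∑ u, A j * (prodWeight w u * (o (u j) * f u)) := by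
          refine Finset.sum_congr rfl fun j _ => ?_
          rw [← Finset.mul_sum]
      _ = ∑ u, ∑ j, A j * (prodWeight w u * (o (u j) * f u)) := Finset.sum_comm
      _ = _ := by
          refine Finset.sum_congr rfl fun u _ => ?_
          rw [Finset.sum_mul, Finset.mul_sum]
          exact Finset.sum_congr rfl fun j _ => by ring
  have e2 : ∑ u, prodWeight w u * S u ^ 2 ≤ c ^ 2 * Q := by
    have : ∑ u, prodWeight w u * S u ^ 2
        = ∑ i, ∑ j, A i * A j * ∑ u, prodWeight w u * (o (u i) * o (u j)) := by
      simp only [Finset.mul_sum]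
      rw [Finset.sum_congr rfl fun i _ => Finset.sum_comm, Finset.sum_comm]
      refine Finset.sum_congr rfl fun u _ => ?_
      simp only [hS]
      rw [sq, Finset.sum_mul_sum, Finset.mul_sum]
      refine Finset.sum_congr rfl fun i _ => ?_
      rw [Finset.mul_sum]
      exact Finset.sum_congr rfl fun j _ => by ring
    rw [this, hQ, Finset.mul_sum]
    refine Finset.sum_le_sum fun i _ => ?_
    rw [Finset.sum_eq_single i]
    · rw [sum_prodWeight_mul_apply h1 i fun a => o a * o a]
      have : ∑ a, w a * (o a * o a) ≤ c ^ 2 := by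
        calc _ ≤ ∑ a, w a * c ^ 2 := by
              refine Finset.sum_le_sum fun a _ => mul_le_mul_of_nonneg_left ?_ (hw a)
              rw [← sq]
              exact sq_le_sq' (by linarith [(abs_le.1 (ho a)).1]) (abs_le.1 (ho a)).2
          _ = c ^ 2 := by rw [← Finset.sum_mul, h1, one_mul]
      nlinarith [mul_le_mul_of_nonneg_left this (mul_self_nonneg (A i))]
    · intro j _ hj
      rw [sum_prodWeight_mul_apply_mul_apply h0 hj.symm, mul_zero]
    · simp
  have e3 : Q ^ 2 ≤ (∑ u, prodWeight w u * S u ^ 2) * E := by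
    rw [e1]
    refine Finset.sum_sq_le_sum_mul_sum_of_sq_le_mul _ (fun u _ => mul_nonneg (hW u) (sq_nonneg _))
      (fun u _ => mul_nonneg (hW u) (sq_nonneg _)) fun u _ => le_of_eq (by ring)
  rcases hQ0.eq_or_lt with h | h
  · rw [← h]; positivity
  · have : Q ^ 2 ≤ (c ^ 2 * Q) * E := e3.trans (mul_le_mul_of_nonneg_right e2 hE0)
    nlinarith

/-- The element of `ι → H` with coordinates `0`, `e` or `-e` prescribed by a sign vector. -/
def signStep {ι H : Type*} [AddCommGroup H] (e : H) (ξ : ι → SignType) : ι → H :=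
  fun j => ((ξ j : SignType) : ℤ) • e

/-- Smoothing of a function on the group `ι → H` by a product weight. -/
def smoothing {ι H : Type*} [Fintype ι] [DecidableEq ι] [Fintype H] [AddCommGroup H]
    (w : H → ℝ) (F : (ι → H) → ℝ) (x : ι → H) : ℝ :=
  ∑ u : ι → H, prodWeight w u * F (x + u)

/-- The discrete logarithmic derivative of a weight. -/
noncomputable def score {H : Type*} [AddCommGroup H] (w : H → ℝ) (e : H) (a : H) : ℝ :=
  (w (a - e) - w (a + e)) / w a

lemma sum_add_right {G β : Type*} [Fintype G] [AddCommGroup G] [AddCommMonoid β] (f : G → β)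
    (v : G) : ∑ x, f (x + v) = ∑ x, f x :=
  Fintype.sum_equiv (Equiv.addRight v) _ _ fun _ => rfl

lemma sum_sub_right {G β : Type*} [Fintype G] [AddCommGroup G] [AddCommMonoid β] (f : G → β)
    (v : G) : ∑ x, f (x - v) = ∑ x, f x :=
  Fintype.sum_equiv (Equiv.subRight v) _ _ fun _ => rfl

lemma abs_score_le {H : Type*} [AddCommGroup H] {w : H → ℝ} {e : H} {κ : ℝ}
    (hm : ∀ a, |w (a - e) / w a - 1| ≤ κ)
    (hp : ∀ a, |w (a + e) / w a - 1| ≤ κ) (a : H) : |score w e a| ≤ 2 * κ := by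
  have : score w e a = (w (a - e) / w a - 1) - (w (a + e) / w a - 1) := by
    rw [score]; ring
  rw [this]
  linarith [abs_sub (w (a - e) / w a - 1) (w (a + e) / w a - 1), hm a, hp a]

section Smoothing

variable {n : ℕ} {H : Type*} [Fintype H] [AddCommGroup H] {w : H → ℝ} {e : H}
  {κ : ℝ}

lemma sum_mul_score (hw : ∀ a, 0 < w a) : ∑ a, w a * score w e a = 0 := by
  have : ∀ a, w a * score w e a = w (a - e) - w (a + e) := fun a => by
    rw [score, mul_div_cancel₀ _ (hw a).ne']
  simp only [this, Finset.sum_sub_distrib]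
  rw [sum_sub_right, sum_add_right, sub_self]

lemma abs_smoothing_sub_le (hw : ∀ a, 0 < w a) (h1 : ∑ a, w a = 1) (hκ : κ ≤ 1)
    (hm : ∀ a, |w (a - e) / w a - 1| ≤ κ) (hp : ∀ a, |w (a + e) / w a - 1| ≤ κ)
    (F : (Fin n → H) → ℝ) (y : Fin n → H) (ξ : Fin n → SignType) :
    |smoothing w F (y + signStep e ξ) - smoothing w F (y - signStep e ξ)
      - ∑ j, (ξ j : ℝ) * ∑ u, prodWeight w u * (score w e (u j) * (F (y + u) - F y))|
    ≤ 2 * (κ ^ 2 * 2 ^ n) * ∑ u, prodWeight w u * |F (y + u) - F y| := by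
  have hκ0 : 0 ≤ κ := (abs_nonneg _).trans (hm 0)
  set h := signStep e ξ with hh
  let rm : (Fin n → H) → Fin n → ℝ := fun u j => w (u j - h j) / w (u j) - 1
  let rp : (Fin n → H) → Fin n → ℝ := fun u j => w (u j + h j) / w (u j) - 1
  have key : ∀ (a : H) (s : SignType), |w (a - (s : ℤ) • e) / w a - 1| ≤ κ ∧
      |w (a + (s : ℤ) • e) / w a - 1| ≤ κ ∧
      (w (a - (s : ℤ) • e) / w a - 1) - (w (a + (s : ℤ) • e) / w a - 1) = s * score w e a := by
    intro a s
    have ha := (hw a).ne'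
    cases s with
    | zero => simp [ha, hκ0]
    | neg =>
      refine ⟨by simpa using hp a, by simpa [← sub_eq_add_neg] using hm a, ?_⟩
      simp [score, ← sub_eq_add_neg]; ring
    | pos =>
      refine ⟨by simpa using hm a, by simpa using hp a, ?_⟩
      simp [score]; ring
  have hrm : ∀ u j, |rm u j| ≤ κ := fun u j => (key (u j) (ξ j)).1
  have hrp : ∀ u j, |rp u j| ≤ κ := fun u j => (key (u j) (ξ j)).2.1
  have hr : ∀ u j, rm u j - rp u j = (ξ j : ℝ) * score w e (u j) :=
    fun u j => (key (u j) (ξ j)).2.2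
  have sh : ∀ v : Fin n → H, smoothing w F (y + v)
      = F y + ∑ u, prodWeight w (u - v) * (F (y + u) - F y) := by
    intro v
    simp only [mul_sub, Finset.sum_sub_distrib]
    rw [← Finset.sum_mul, sum_sub_right, sum_prodWeight h1, one_mul,
      add_sub_cancel, smoothing, ← sum_sub_right _ v]
    refine Finset.sum_congr rfl fun u _ => ?_
    simp [add_assoc]
  have prm : ∀ u, prodWeight w (u - h) = prodWeight w u * ∏ j, (1 + rm u j) := by
    intro u
    rw [prodWeight, prodWeight, ← Finset.prod_mul_distrib]
    refine Finset.prod_congr rfl fun j _ => ?_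
    have := (hw (u j)).ne'
    simp only [rm, Pi.sub_apply]; field_simp; ring
  have prp : ∀ u, prodWeight w (u - -h) = prodWeight w u * ∏ j, (1 + rp u j) := by
    intro u
    rw [prodWeight, prodWeight, ← Finset.prod_mul_distrib]
    refine Finset.prod_congr rfl fun j _ => ?_
    have := (hw (u j)).ne'
    simp only [rp, Pi.sub_apply, Pi.neg_apply, sub_neg_eq_add]; field_simp; ring
  have e1 : smoothing w F (y + h) - smoothing w F (y - h)
      - ∑ j, (ξ j : ℝ) * ∑ u, prodWeight w u * (score w e (u j) * (F (y + u) - F y))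
      = ∑ u, prodWeight w u * (((∏ j, (1 + rm u j) - 1 - ∑ j, rm u j)
          - (∏ j, (1 + rp u j) - 1 - ∑ j, rp u j)) * (F (y + u) - F y)) := by
    have e2 : ∑ j, (ξ j : ℝ) * ∑ u, prodWeight w u * (score w e (u j) * (F (y + u) - F y))
        = ∑ u, prodWeight w u * ((∑ j, rm u j - ∑ j, rp u j) * (F (y + u) - F y)) := by
      simp only [Finset.mul_sum, ← Finset.sum_sub_distrib, hr, Finset.sum_mul]
      rw [Finset.sum_comm]
      exact Finset.sum_congr rfl fun u _ => Finset.sum_congr rfl fun j _ => by ring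
    rw [sub_eq_add_neg y h, sh h, sh (-h), e2, add_sub_add_left_eq_sub, ← Finset.sum_sub_distrib,
      ← Finset.sum_sub_distrib]
    refine Finset.sum_congr rfl fun u _ => ?_
    rw [prm, prp]; ring
  rw [e1, Finset.mul_sum]
  refine (Finset.abs_sum_le_sum_abs _ _).trans (Finset.sum_le_sum fun u _ => ?_)
  have hW := prodWeight_nonneg (fun a => (hw a).le) u
  have b1 := abs_prod_one_add_sub_le univ hκ (hrm u)
  have b2 := abs_prod_one_add_sub_le univ hκ (hrp u)
  simp only [Finset.card_univ, Fintype.card_fin] at b1 b2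
  rw [abs_mul, abs_mul, abs_of_nonneg hW]
  have b3 := (abs_sub (∏ j, (1 + rm u j) - 1 - ∑ j, rm u j)
    (∏ j, (1 + rp u j) - 1 - ∑ j, rp u j)).trans (add_le_add b1 b2)
  calc _ ≤ prodWeight w u * ((κ ^ 2 * 2 ^ n + κ ^ 2 * 2 ^ n) * |F (y + u) - F y|) := by gcongr
    _ = _ := by ring

lemma sum_abs_smoothing_translate_le {p : ℝ} (hp : 1 ≤ p) (g : (Fin n → H) → ℝ) (h : Fin n → H)
    (M : ℕ) : ∑ x, |g (x + (2 * M) • h) - g x| ^ p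
      ≤ (M : ℝ) ^ p * ∑ y, |g (y + h) - g (y - h)| ^ p := by
  have tel : ∀ x, g (x + (2 * M) • h) - g x
      = ∑ i ∈ range M, (g (x + (2 * i + 1) • h + h) - g (x + (2 * i + 1) • h - h)) := by
    intro x
    have := Finset.sum_range_sub (fun i : ℕ => g (x + (2 * i) • h)) M
    simp only [mul_zero, zero_smul, add_zero] at this
    rw [← this]
    refine Finset.sum_congr rfl fun i _ => ?_
    congr 2
    · rw [add_assoc, ← succ_nsmul]; rfl
    · rw [succ_nsmul, ← add_assoc, add_sub_cancel_right]
  calc ∑ x, |g (x + (2 * M) • h) - g x| ^ p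
      ≤ ∑ x, (M : ℝ) ^ (p - 1) * ∑ i ∈ range M,
          |g (x + (2 * i + 1) • h + h) - g (x + (2 * i + 1) • h - h)| ^ p := by
        refine Finset.sum_le_sum fun x _ => ?_
        rw [tel]
        have := Real.rpow_sum_le_const_mul_sum_rpow (range M) (fun i =>
          g (x + (2 * i + 1) • h + h) - g (x + (2 * i + 1) • h - h)) hp
        rw [Finset.card_range] at this
        exact (Real.rpow_le_rpow (abs_nonneg _) (Finset.abs_sum_le_sum_abs _ _)
          (by linarith)).trans this
    _ = (M : ℝ) ^ (p - 1) * ∑ i ∈ range M, ∑ y, |g (y + h) - g (y - h)| ^ p := by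
        rw [← Finset.mul_sum, Finset.sum_comm]
        congr 1
        refine Finset.sum_congr rfl fun i _ => ?_
        exact sum_add_right (fun y => |g (y + h) - g (y - h)| ^ p) _
    _ = _ := by
        rw [Finset.sum_const, Finset.card_range, nsmul_eq_mul, ← mul_assoc]
        congr 1
        rcases Nat.eq_zero_or_pos M with rfl | hM
        · simp [Real.zero_rpow (by linarith : p ≠ 0)]
        · have : (0:ℝ) < M := by exact_mod_cast hM
          nth_rewrite 2 [← Real.rpow_one (M : ℝ)]
          rw [← Real.rpow_add this]; simp

lemma abs_sum_score_rpow_le (hw : ∀ a, 0 < w a) (h1 : ∑ a, w a = 1)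
    (hm : ∀ a, |w (a - e) / w a - 1| ≤ κ) (hp : ∀ a, |w (a + e) / w a - 1| ≤ κ)
    {p : ℝ} (h1p : 1 ≤ p)
    (F : (Fin n → H) → ℝ) (y : Fin n → H) (j : Fin n) :
    |∑ u, prodWeight w u * (score w e (u j) * (F (y + u) - F y))| ^ p
      ≤ (2 * κ) ^ p * ∑ u, prodWeight w u * |F (y + u) - F (y + Function.update u j 0)| ^ p := by
  have hκ0 : 0 ≤ κ := (abs_nonneg _).trans (hm 0)
  have h0 := sum_prodWeight_mul_update (ι := Fin n) (sum_mul_score (e := e) hw) j 0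
    fun u => F (y + u) - F y
  have e1 : ∑ u, prodWeight w u * (score w e (u j) * (F (y + u) - F y))
      = ∑ u, prodWeight w u * (score w e (u j) * (F (y + u) - F (y + Function.update u j 0))) := by
    rw [← sub_eq_zero, ← h0, ← Finset.sum_sub_distrib]
    exact Finset.sum_congr rfl fun u _ => by ring
  rw [e1, Finset.mul_sum]
  refine (abs_sum_mul_rpow_le (prodWeight_nonneg fun a => (hw a).le) (sum_prodWeight h1) _
    h1p).trans (Finset.sum_le_sum fun u _ => ?_)
  have hW := prodWeight_nonneg (fun a => (hw a).le) u
  rw [abs_mul, Real.mul_rpow (abs_nonneg _) (abs_nonneg _)]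
  have : |score w e (u j)| ^ p ≤ (2 * κ) ^ p :=
    Real.rpow_le_rpow (abs_nonneg _) (abs_score_le hm hp _) (by linarith)
  calc _ ≤ prodWeight w u * ((2 * κ) ^ p * |F (y + u) - F (y + Function.update u j 0)| ^ p) := by
        gcongr
    _ = _ := by ring

end Smoothing

lemma sum_weight_mul_add {Ω : Type*} [Fintype Ω] {W : Ω → ℝ} (h1 : ∑ a, W a = 1) (z : Ω → ℝ)
    (b c : ℝ) : ∑ a, W a * (b * z a + c) = b * ∑ a, W a * z a + c := by
  simp only [mul_add, Finset.sum_add_distrib, ← Finset.sum_mul, h1, one_mul, Finset.mul_sum]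
  exact congrArg (· + c) (Finset.sum_congr rfl fun a _ => by ring)

lemma exists_smoothing_increment_le {p : ℝ} (hp : 2 < p) : ∃ C : ℝ, 0 < C ∧
    ∀ (n M : ℕ) (H : Type) [Fintype H] [AddCommGroup H] (w : H → ℝ) (e : H) (κ δ : ℝ),
    (∀ a, 0 < w a) → ∑ a, w a = 1 → κ ≤ 1 → (∀ a, |w (a - e) / w a - 1| ≤ κ) →
    (∀ a, |w (a + e) / w a - 1| ≤ κ) → 0 ≤ δ → δ ≤ 1 → (M * κ) ^ 2 * δ ≤ 4 →
    M * (κ ^ 2 * 2 ^ n) ≤ 1 → ∀ (F : (Fin n → H) → ℝ) (y : Fin n → H),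
    (M : ℝ) ^ p * ∑ ξ : Fin n → SignType, prodWeight (signWeight δ) ξ *
        |smoothing w F (y + signStep e ξ) - smoothing w F (y - signStep e ξ)| ^ p
      ≤ C * (∑ u, prodWeight w u * |F (y + u) - F y| ^ p + δ * (M * κ) ^ p *
        ∑ j, ∑ u, prodWeight w u * |F (y + u) - F (y + Function.update u j 0)| ^ p) := by
  obtain ⟨C, hC, hR⟩ := exists_rosenthal hp
  refine ⟨2 ^ p * (C * 4 ^ p + 2 ^ p), by positivity, ?_⟩
  intro n M H _ _ w e κ δ hw h1 hκ hm hpl hδ0 hδ1 hMδ hMn F y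
  have hp0 : 0 < p := by linarith
  have hp1 : 1 ≤ p := by linarith
  have hκ0 : 0 ≤ κ := (abs_nonneg _).trans (hm 0)
  have hW : ∀ u : Fin n → H, 0 ≤ prodWeight w u := prodWeight_nonneg fun a => (hw a).le
  have hW1 : ∑ u : Fin n → H, prodWeight w u = 1 := sum_prodWeight h1
  have hS : ∀ ξ : Fin n → SignType, 0 ≤ prodWeight (signWeight δ) ξ :=
    prodWeight_nonneg (signWeight_nonneg hδ0 hδ1)
  have hS1 : ∑ ξ : Fin n → SignType, prodWeight (signWeight δ) ξ = 1 :=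
    sum_prodWeight (sum_signWeight δ)
  set V := ∑ u, prodWeight w u * |F (y + u) - F y| ^ p with hV
  have hV0 : 0 ≤ V := Finset.sum_nonneg fun u _ => mul_nonneg (hW u) (by positivity)
  set U : Fin n → ℝ := fun j =>
    ∑ u, prodWeight w u * |F (y + u) - F (y + Function.update u j 0)| ^ p with hU
  have hU0 : 0 ≤ ∑ j, U j := Finset.sum_nonneg fun j _ =>
    Finset.sum_nonneg fun u _ => mul_nonneg (hW u) (by positivity)
  set A : Fin n → ℝ := fun j =>
    ∑ u, prodWeight w u * (score w e (u j) * (F (y + u) - F y)) with hA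
  have hAp : ∑ j, |A j| ^ p ≤ (2 * κ) ^ p * ∑ j, U j := by
    rw [Finset.mul_sum]
    exact Finset.sum_le_sum fun j _ => abs_sum_score_rpow_le hw h1 hm hpl hp1 F y j
  set E := ∑ u, prodWeight w u * (F (y + u) - F y) ^ 2 with hE
  have hE0 : 0 ≤ E := Finset.sum_nonneg fun u _ => mul_nonneg (hW u) (by positivity)
  have hA2 : ∑ j, A j ^ 2 ≤ (2 * κ) ^ 2 * E :=
    sum_sq_le_of_bounded (fun a => (hw a).le) h1 (sum_mul_score hw) (abs_score_le hm hpl) _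
  have hEV : E ^ (p / 2) ≤ V := by
    have := Real.rpow_arith_mean_le_arith_mean_rpow univ (prodWeight w)
      (fun u => (F (y + u) - F y) ^ 2) (fun u _ => hW u) hW1 (fun u _ => sq_nonneg _)
      (show 1 ≤ p / 2 by linarith)
    refine this.trans_eq (Finset.sum_congr rfl fun u _ => ?_)
    rw [← sq_abs, ← Real.rpow_natCast, ← Real.rpow_mul (abs_nonneg _)]
    congr 2; push_cast; ring
  have hEV1 : ∑ u, prodWeight w u * |F (y + u) - F y| ≤ V ^ (1 / p) := by
    have := Real.rpow_arith_mean_le_arith_mean_rpow univ (prodWeight w)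
      (fun u => |F (y + u) - F y|) (fun u _ => hW u) hW1 (fun u _ => abs_nonneg _) hp1
    rw [one_div, ← Real.rpow_le_rpow_iff (z := p) _ (by positivity) hp0,
      Real.rpow_inv_rpow hV0 hp0.ne']
    · exact this
    · exact Finset.sum_nonneg fun u _ => mul_nonneg (hW u) (abs_nonneg _)
  have hpt : ∀ ξ : Fin n → SignType,
      |smoothing w F (y + signStep e ξ) - smoothing w F (y - signStep e ξ)| ^ p
        ≤ 2 ^ p * |∑ j, (ξ j : ℝ) * A j| ^ p + 2 ^ p * ((2 * (κ ^ 2 * 2 ^ n)) ^ p * V) := by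
    intro ξ
    set D := smoothing w F (y + signStep e ξ) - smoothing w F (y - signStep e ξ)
    have h3 := abs_smoothing_sub_le hw h1 hκ hm hpl F y ξ
    have h4 : |D - ∑ j, (ξ j : ℝ) * A j| ^ p ≤ (2 * (κ ^ 2 * 2 ^ n)) ^ p * V := by
      have h5 : |D - ∑ j, (ξ j : ℝ) * A j| ≤ 2 * (κ ^ 2 * 2 ^ n) * V ^ (1 / p) :=
        h3.trans (mul_le_mul_of_nonneg_left hEV1 (by positivity))
      refine (Real.rpow_le_rpow (abs_nonneg _) h5 hp0.le).trans_eq ?_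
      rw [Real.mul_rpow (by positivity) (by positivity), one_div, Real.rpow_inv_rpow hV0 hp0.ne']
    have h6 := abs_add_rpow_le hp1 (∑ j, (ξ j : ℝ) * A j) (D - ∑ j, (ξ j : ℝ) * A j)
    rw [add_sub_cancel] at h6
    refine h6.trans ?_
    rw [mul_add]
    gcongr
  have hM0 : (0:ℝ) ≤ M := Nat.cast_nonneg M
  have hsq : (δ * ∑ j, A j ^ 2) ^ (p / 2) ≤ (δ * (2 * κ) ^ 2) ^ (p / 2) * V := by
    refine (Real.rpow_le_rpow (by positivity)
      (mul_le_mul_of_nonneg_left hA2 hδ0) (by positivity)).trans ?_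
    rw [← mul_assoc, Real.mul_rpow (by positivity) hE0]
    gcongr
  have hMp : (M : ℝ) ^ p = ((M : ℝ) ^ 2) ^ (p / 2) := by
    rw [← Real.rpow_natCast, ← Real.rpow_mul hM0]; congr 1; push_cast; ring
  have c1 : (M : ℝ) ^ p * (δ * (2 * κ) ^ 2) ^ (p / 2) ≤ 4 ^ p := by
    rw [hMp, ← Real.mul_rpow (by positivity) (by positivity)]
    have : (4 : ℝ) ^ p = ((4:ℝ) ^ 2) ^ (p / 2) := by
      rw [← Real.rpow_natCast, ← Real.rpow_mul (by norm_num)]; congr 1; push_cast; ring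
    rw [this]
    refine Real.rpow_le_rpow (by positivity) ?_ (by positivity)
    nlinarith
  have c2 : (M : ℝ) ^ p * (2 * (κ ^ 2 * 2 ^ n)) ^ p ≤ 2 ^ p := by
    rw [← Real.mul_rpow hM0 (by positivity)]
    exact Real.rpow_le_rpow (by positivity) (by linarith) hp0.le
  have c3 : (M : ℝ) ^ p * (2 * κ) ^ p = 2 ^ p * (M * κ) ^ p := by
    rw [← Real.mul_rpow hM0 (by positivity), ← Real.mul_rpow (by norm_num) (by positivity)]
    congr 1; ring
  have c4 : (2:ℝ) ^ p ≤ 4 ^ p := Real.rpow_le_rpow (by norm_num) (by norm_num) hp0.le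
  have hRA : ∑ ξ : Fin n → SignType, prodWeight (signWeight δ) ξ * |∑ j, (ξ j : ℝ) * A j| ^ p
      ≤ C * (δ * ((2 * κ) ^ p * ∑ j, U j) + (δ * (2 * κ) ^ 2) ^ (p / 2) * V) := by
    refine (hR δ hδ0 hδ1 n A).trans ?_
    gcongr
  set T := ∑ j, U j
  have hX : 0 ≤ (M * κ) ^ p := by positivity
  clear_value V T
  calc (M : ℝ) ^ p * ∑ ξ : Fin n → SignType, prodWeight (signWeight δ) ξ *
        |smoothing w F (y + signStep e ξ) - smoothing w F (y - signStep e ξ)| ^ p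
      ≤ (M : ℝ) ^ p * ∑ ξ : Fin n → SignType, prodWeight (signWeight δ) ξ *
        (2 ^ p * |∑ j, (ξ j : ℝ) * A j| ^ p + 2 ^ p * ((2 * (κ ^ 2 * 2 ^ n)) ^ p * V)) := by
        gcongr with ξ _
        · exact hS ξ
        · exact hpt ξ
    _ = (M : ℝ) ^ p * (2 ^ p * (∑ ξ : Fin n → SignType, prodWeight (signWeight δ) ξ *
          |∑ j, (ξ j : ℝ) * A j| ^ p) + 2 ^ p * ((2 * (κ ^ 2 * 2 ^ n)) ^ p * V)) := by
        rw [sum_weight_mul_add hS1]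
    _ ≤ (M : ℝ) ^ p * (2 ^ p * (C * (δ * ((2 * κ) ^ p * T) + (δ * (2 * κ) ^ 2) ^ (p / 2) * V))
          + 2 ^ p * ((2 * (κ ^ 2 * 2 ^ n)) ^ p * V)) := by gcongr
    _ = 2 ^ p * (C * (δ * (((M : ℝ) ^ p * (2 * κ) ^ p) * T)
          + ((M : ℝ) ^ p * (δ * (2 * κ) ^ 2) ^ (p / 2)) * V)
          + ((M : ℝ) ^ p * (2 * (κ ^ 2 * 2 ^ n)) ^ p) * V) := by ring
    _ ≤ 2 ^ p * (C * (δ * ((4 ^ p * (M * κ) ^ p) * T) + 4 ^ p * V) + 2 ^ p * V) := by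
        rw [c3]; gcongr
    _ ≤ 2 ^ p * (C * 4 ^ p + 2 ^ p) * (V + δ * (M * κ) ^ p * T) := by
        have h7 : 0 ≤ (2:ℝ) ^ p * 2 ^ p * (δ * (M * κ) ^ p * T) := by positivity
        linarith

/-- A smooth metric `X_p` inequality for real functions on a finite group `Fin n → H`. -/
lemma exists_metric_Xp_inequality {p : ℝ} (hp : 2 < p) : ∃ C : ℝ, 0 < C ∧
    ∀ (n M : ℕ) (H : Type) [Fintype H] [AddCommGroup H] (w : H → ℝ) (e : H) (κ δ : ℝ),
    (∀ a, 0 < w a) → ∑ a, w a = 1 → κ ≤ 1 → (∀ a, |w (a - e) / w a - 1| ≤ κ) →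
    (∀ a, |w (a + e) / w a - 1| ≤ κ) → 0 ≤ δ → δ ≤ 1 → (M * κ) ^ 2 * δ ≤ 4 →
    M * (κ ^ 2 * 2 ^ n) ≤ 1 → ∀ F : (Fin n → H) → ℝ,
    ∑ x : Fin n → H, ∑ ξ : Fin n → SignType, prodWeight (signWeight δ) ξ *
        |F (x + (2 * M) • signStep e ξ) - F x| ^ p
      ≤ C * (∑ x : Fin n → H, ∑ u, prodWeight w u * |F (x + u) - F x| ^ p + δ * (M * κ) ^ p *
        ∑ x : Fin n → H, ∑ j, ∑ u, prodWeight w u * |F (x + u) - F (x + Function.update u j 0)| ^ p) := by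
  obtain ⟨C, hC, hinc⟩ := exists_smoothing_increment_le hp
  refine ⟨2 ^ p + 2 ^ p * 2 ^ p + 2 ^ p * 2 ^ p * C, by positivity, ?_⟩
  intro n M H _ _ w e κ δ hw h1 hκ hm hpl hδ0 hδ1 hMδ hMn F
  have hp0 : 0 < p := by linarith
  have hp1 : 1 ≤ p := by linarith
  have hκ0 : 0 ≤ κ := (abs_nonneg _).trans (hm 0)
  have hW : ∀ u : Fin n → H, 0 ≤ prodWeight w u := prodWeight_nonneg fun a => (hw a).le
  have hS : ∀ ξ : Fin n → SignType, 0 ≤ prodWeight (signWeight δ) ξ :=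
    prodWeight_nonneg (signWeight_nonneg hδ0 hδ1)
  have hS1 : ∑ ξ : Fin n → SignType, prodWeight (signWeight δ) ξ = 1 :=
    sum_prodWeight (sum_signWeight δ)
  set V := ∑ x : Fin n → H, ∑ u, prodWeight w u * |F (x + u) - F x| ^ p with hV
  set T := ∑ x : Fin n → H, ∑ j, ∑ u, prodWeight w u * |F (x + u) - F (x + Function.update u j 0)| ^ p
    with hT
  have hT0 : 0 ≤ T := Finset.sum_nonneg fun x _ => Finset.sum_nonneg fun j _ =>
    Finset.sum_nonneg fun u _ => mul_nonneg (hW u) (by positivity)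
  set g := smoothing w F with hg
  have hgF : ∑ x, |g x - F x| ^ p ≤ V := by
    refine Finset.sum_le_sum fun x _ => ?_
    have : g x - F x = ∑ u, prodWeight w u * (F (x + u) - F x) := by
      simp only [mul_sub, Finset.sum_sub_distrib, ← Finset.sum_mul, sum_prodWeight h1, one_mul]
      rfl
    rw [this]
    exact abs_sum_mul_rpow_le hW (sum_prodWeight h1) _ hp1
  have hfix : ∀ h : Fin n → H, ∑ x, |F (x + (2 * M) • h) - F x| ^ p
      ≤ (2 ^ p + 2 ^ p * 2 ^ p) * V
        + 2 ^ p * 2 ^ p * ((M : ℝ) ^ p * ∑ y, |g (y + h) - g (y - h)| ^ p) := by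
    intro h
    set t := (2 * M) • h with ht
    have hpt : ∀ x, |F (x + t) - F x| ^ p ≤ 2 ^ p * |g (x + t) - F (x + t)| ^ p
        + 2 ^ p * 2 ^ p * |g x - F x| ^ p + 2 ^ p * 2 ^ p * |g (x + t) - g x| ^ p := by
      intro x
      have k1 := abs_add_rpow_le hp1 (F (x + t) - g (x + t)) (g (x + t) - F x)
      have k2 := abs_add_rpow_le hp1 (g (x + t) - g x) (g x - F x)
      rw [sub_add_sub_cancel] at k1 k2
      rw [abs_sub_comm (F (x + t)) (g (x + t))] at k1
      have k3 := mul_le_mul_of_nonneg_left k2 (by positivity : (0:ℝ) ≤ 2 ^ p)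
      linarith
    refine (Finset.sum_le_sum fun x _ => hpt x).trans ?_
    rw [Finset.sum_add_distrib, Finset.sum_add_distrib, ← Finset.mul_sum, ← Finset.mul_sum,
      ← Finset.mul_sum, sum_add_right fun x => |g x - F x| ^ p]
    have k4 := sum_abs_smoothing_translate_le hp1 g h M
    have k5 := mul_le_mul_of_nonneg_left hgF (by positivity : (0:ℝ) ≤ 2 ^ p + 2 ^ p * 2 ^ p)
    have k6 := mul_le_mul_of_nonneg_left k4 (by positivity : (0:ℝ) ≤ 2 ^ p * 2 ^ p)
    linarith
  have hD : (M : ℝ) ^ p * ∑ ξ : Fin n → SignType, prodWeight (signWeight δ) ξ *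
      ∑ y, |g (y + signStep e ξ) - g (y - signStep e ξ)| ^ p
      ≤ C * (V + δ * (M * κ) ^ p * T) := by
    have := Finset.sum_le_sum fun (y : Fin n → H) (_ : y ∈ univ) =>
      hinc n M H w e κ δ hw h1 hκ hm hpl hδ0 hδ1 hMδ hMn F y
    rw [← Finset.mul_sum, ← Finset.mul_sum, Finset.sum_add_distrib, ← Finset.mul_sum] at this
    refine le_trans (le_of_eq ?_) this
    rw [Finset.sum_comm]
    simp only [Finset.mul_sum, hg]
  clear_value V T g
  calc ∑ x : Fin n → H, ∑ ξ : Fin n → SignType, prodWeight (signWeight δ) ξ *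
        |F (x + (2 * M) • signStep e ξ) - F x| ^ p
      = ∑ ξ : Fin n → SignType, prodWeight (signWeight δ) ξ *
        ∑ x, |F (x + (2 * M) • signStep e ξ) - F x| ^ p := by
        rw [Finset.sum_comm]; simp only [Finset.mul_sum]
    _ ≤ ∑ ξ : Fin n → SignType, prodWeight (signWeight δ) ξ * ((2 ^ p + 2 ^ p * 2 ^ p) * V
        + 2 ^ p * 2 ^ p * ((M : ℝ) ^ p *
          ∑ y, |g (y + signStep e ξ) - g (y - signStep e ξ)| ^ p)) :=
        Finset.sum_le_sum fun ξ _ => mul_le_mul_of_nonneg_left (hfix _) (hS ξ)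
    _ = (2 ^ p + 2 ^ p * 2 ^ p) * V + 2 ^ p * 2 ^ p * ((M : ℝ) ^ p *
          ∑ ξ : Fin n → SignType, prodWeight (signWeight δ) ξ *
            ∑ y, |g (y + signStep e ξ) - g (y - signStep e ξ)| ^ p) := by
        have := sum_weight_mul_add hS1 (fun ξ => ∑ y, |g (y + signStep e ξ)
          - g (y - signStep e ξ)| ^ p) (2 ^ p * 2 ^ p * (M : ℝ) ^ p)
          ((2 ^ p + 2 ^ p * 2 ^ p) * V)
        rw [← mul_assoc (2 ^ p * 2 ^ p), add_comm ((2 ^ p + 2 ^ p * 2 ^ p) * V), ← this]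
        exact Finset.sum_congr rfl fun ξ _ => by ring
    _ ≤ (2 ^ p + 2 ^ p * 2 ^ p) * V + 2 ^ p * 2 ^ p * (C * (V + δ * (M * κ) ^ p * T)) := by
        gcongr
    _ ≤ _ := by
        have : 0 ≤ ((2:ℝ) ^ p + 2 ^ p * 2 ^ p) * (δ * (M * κ) ^ p * T) := by positivity
        linarith

section CyclicKernel

/-- The distance to `0` in the cyclic group `ZMod N`. -/
def cyclicNorm {N : ℕ} (a : ZMod N) : ℕ := a.valMinAbs.natAbs

lemma cyclicNorm_add_le {N : ℕ} (a b : ZMod N) :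
    cyclicNorm (a + b) ≤ cyclicNorm a + cyclicNorm b :=
  (ZMod.natAbs_valMinAbs_add_le a b).trans (Int.natAbs_add_le _ _)

lemma cyclicNorm_neg {N : ℕ} (a : ZMod N) : cyclicNorm (-a) = cyclicNorm a :=
  ZMod.natAbs_valMinAbs_neg a

lemma cyclicNorm_one_le {N : ℕ} [NeZero N] : cyclicNorm (1 : ZMod N) ≤ 1 := by
  rw [cyclicNorm, ZMod.valMinAbs_natAbs_eq_min]
  refine (min_le_left _ _).trans ?_
  rw [ZMod.val_one_eq_one_mod]
  exact Nat.mod_le _ _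

lemma abs_cyclicNorm_sub_le {N : ℕ} (a b : ZMod N) :
    |(cyclicNorm a : ℝ) - cyclicNorm b| ≤ cyclicNorm (a - b) := by
  have h1 := cyclicNorm_add_le (a - b) b
  have h2 := cyclicNorm_add_le (-(a - b)) a
  rw [cyclicNorm_neg] at h2
  rw [sub_add_cancel] at h1
  rw [neg_sub, sub_add_cancel] at h2
  have h1' : (cyclicNorm a : ℝ) ≤ cyclicNorm (a - b) + cyclicNorm b := by exact_mod_cast h1
  have h2' : (cyclicNorm b : ℝ) ≤ cyclicNorm (a - b) + cyclicNorm a := by exact_mod_cast h2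
  rw [abs_le]
  constructor <;> linarith

lemma sum_zmod_val {N : ℕ} [NeZero N] (g : ℕ → ℝ) :
    ∑ a : ZMod N, g a.val = ∑ k ∈ Finset.range N, g k := by
  obtain ⟨k, rfl⟩ : ∃ k, N = k + 1 := Nat.exists_eq_succ_of_ne_zero (NeZero.ne N)
  exact Fin.sum_univ_eq_sum_range g _

lemma sum_exp_neg_range_le {t : ℝ} (ht : 0 < t) (N : ℕ) :
    ∑ k ∈ Finset.range N, Real.exp (-(k * t)) ≤ 1 + 1 / t := by
  have h1 : ∀ k : ℕ, Real.exp (-(k * t)) = Real.exp (-t) ^ k := fun k => by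
    rw [← Real.exp_nat_mul]; congr 1; ring
  simp only [h1]
  have h2 : (∑ k ∈ Finset.range N, Real.exp (-t) ^ k) * (1 - Real.exp (-t)) ≤ 1 := by
    rw [geom_sum_mul_neg]
    have := pow_nonneg (Real.exp_pos (-t)).le N
    linarith
  have h3 : t ≤ (1 - Real.exp (-t)) * (1 + t) := by
    have h4 : (1 + t) * Real.exp (-t) ≤ 1 := by
      rw [Real.exp_neg, ← div_eq_mul_inv, div_le_one (Real.exp_pos _)]
      linarith [Real.add_one_le_exp t]
    linarith
  have h0 : 0 ≤ ∑ k ∈ Finset.range N, Real.exp (-t) ^ k :=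
    Finset.sum_nonneg fun k _ => by positivity
  have h5 : (∑ k ∈ Finset.range N, Real.exp (-t) ^ k) * t ≤ 1 + t := by
    have h6 := mul_le_mul_of_nonneg_left h3 h0
    have h7 := mul_le_mul_of_nonneg_right h2 (by linarith : (0:ℝ) ≤ 1 + t)
    linarith
  rw [← le_div_iff₀ ht] at h5
  refine h5.trans_eq ?_
  field_simp
  ring

lemma sum_exp_neg_cyclicNorm_le {N : ℕ} [NeZero N] {t : ℝ} (ht : 0 < t) :
    ∑ a : ZMod N, Real.exp (-(cyclicNorm a * t)) ≤ 2 * (1 + 1 / t) := by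
  have h1 : ∀ a : ZMod N, Real.exp (-(cyclicNorm a * t))
      ≤ Real.exp (-(a.val * t)) + Real.exp (-((-a).val * t)) := by
    intro a
    have hmin : cyclicNorm a = min a.val (N - a.val) := ZMod.valMinAbs_natAbs_eq_min a
    rcases min_choice a.val (N - a.val) with h | h
    · rw [hmin, h]; linarith [Real.exp_pos (-((-a).val * t))]
    · rw [hmin, h, ZMod.neg_val]
      split_ifs with h0
      · have : Real.exp (-(((N - a.val : ℕ) : ℝ) * t)) ≤ Real.exp (-((0:ℕ) * t)) := by
          apply Real.exp_le_exp.mpr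
          have : (0:ℝ) ≤ ((N - a.val : ℕ) : ℝ) * t := by positivity
          simpa using this
        linarith [Real.exp_pos (-(a.val * t))]
      · linarith [Real.exp_pos (-(a.val * t))]
  refine (Finset.sum_le_sum fun a _ => h1 a).trans ?_
  rw [Finset.sum_add_distrib,
    Fintype.sum_equiv (Equiv.neg (ZMod N)) (fun a => Real.exp (-((-a).val * t)))
      (fun a => Real.exp (-(a.val * t))) (fun _ => rfl),
    sum_zmod_val fun k => Real.exp (-(k * t))]
  linarith [sum_exp_neg_range_le ht N]

lemma le_sum_exp_neg_cyclicNorm {N K : ℕ} [NeZero N] (hK : 0 < K) (hKN : K ≤ N) :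
    K * Real.exp (-1) ≤ ∑ a : ZMod N, Real.exp (-(cyclicNorm a / K)) := by
  have hK' : (0:ℝ) < K := by exact_mod_cast hK
  calc K * Real.exp (-1) = ∑ k ∈ Finset.range K, Real.exp (-1) := by simp
    _ ≤ ∑ k ∈ Finset.range K, Real.exp (-(k / K)) := by
        refine Finset.sum_le_sum fun k hk => Real.exp_le_exp.mpr ?_
        have : (k:ℝ) ≤ K := by exact_mod_cast (Finset.mem_range.mp hk).le
        have := (div_le_one hK').mpr this
        linarith
    _ ≤ ∑ k ∈ Finset.range N, Real.exp (-(k / K)) :=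
        Finset.sum_le_sum_of_subset_of_nonneg (Finset.range_subset_range.mpr hKN)
          fun _ _ _ => (Real.exp_pos _).le
    _ = ∑ a : ZMod N, Real.exp (-(a.val / K)) :=
        (sum_zmod_val fun k => Real.exp (-(k / K))).symm
    _ ≤ _ := by
        refine Finset.sum_le_sum fun a _ => Real.exp_le_exp.mpr ?_
        have : cyclicNorm a ≤ a.val :=
          (ZMod.valMinAbs_natAbs_eq_min a).trans_le (min_le_left _ _)
        gcongr

lemma one_add_rpow_le_exp {p x : ℝ} (hp : 1 ≤ p) (hx : 0 ≤ x) :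
    (1 + x) ^ p ≤ (2 * p) ^ p * Real.exp (x / 2) := by
  have hp0 : 0 < p := by linarith
  have h1 : 1 + x ≤ 2 * p * Real.exp (x / (2 * p)) := by
    have h2 := mul_le_mul_of_nonneg_left (Real.add_one_le_exp (x / (2 * p)))
      (by positivity : 0 ≤ 2 * p)
    have h3 : 2 * p * (x / (2 * p) + 1) = x + 2 * p := by field_simp
    linarith
  refine (Real.rpow_le_rpow (by linarith) h1 hp0.le).trans_eq ?_
  rw [Real.mul_rpow (by positivity) (Real.exp_pos _).le, ← Real.exp_mul]
  congr 2
  field_simp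

/-- A slowly varying probability weight on a cyclic group, concentrated at scale `K`. -/
lemma exists_cyclic_weight {p : ℝ} (hp : 1 ≤ p) : ∃ B : ℝ, 0 < B ∧
    ∀ (N K : ℕ) [NeZero N], 0 < K → K ≤ N → ∃ w : ZMod N → ℝ, (∀ a, 0 < w a) ∧
      ∑ a, w a = 1 ∧ (∀ a, |w (a - 1) / w a - 1| ≤ 2 / K) ∧
      (∀ a, |w (a + 1) / w a - 1| ≤ 2 / K) ∧
      ∀ s : ℝ, 0 ≤ s → s ≤ p → ∑ a, w a * (cyclicNorm a / K : ℝ) ^ s ≤ B := by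
  refine ⟨(2 * p) ^ p * 6 * Real.exp 1, by positivity, ?_⟩
  intro N K _ hK hKN
  have hK' : (1:ℝ) ≤ K := by exact_mod_cast hK
  have hK0 : (0:ℝ) < K := by linarith
  set f : ZMod N → ℝ := fun a => Real.exp (-(cyclicNorm a / K)) with hf
  set Z := ∑ a, f a with hZ
  have hZK : K * Real.exp (-1) ≤ Z := le_sum_exp_neg_cyclicNorm hK hKN
  have hZ0 : 0 < Z := lt_of_lt_of_le (by positivity) hZK
  have hratio : ∀ a b : ZMod N, |(cyclicNorm b : ℝ) - cyclicNorm a| ≤ 1 →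
      |f b / Z / (f a / Z) - 1| ≤ 2 / K := by
    intro a b hab
    have h1 : f b / Z / (f a / Z) = Real.exp ((cyclicNorm a - cyclicNorm b) / K) := by
      rw [div_div_div_cancel_right₀ hZ0.ne', hf, ← Real.exp_sub]
      congr 1; ring
    have h2 : |((cyclicNorm a : ℝ) - cyclicNorm b) / K| ≤ 1 / K := by
      rw [abs_div, abs_of_pos hK0, abs_sub_comm]
      gcongr
    rw [h1]
    refine (Real.abs_exp_sub_one_le (h2.trans ?_)).trans ?_
    · rw [div_le_one hK0]; exact hK'
    · calc 2 * |((cyclicNorm a : ℝ) - cyclicNorm b) / K| ≤ 2 * (1 / K) := by gcongr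
        _ = 2 / K := by ring
  have h1N : (cyclicNorm (1 : ZMod N) : ℝ) ≤ 1 := by exact_mod_cast cyclicNorm_one_le
  refine ⟨fun a => f a / Z, fun a => div_pos (Real.exp_pos _) hZ0, ?_, ?_, ?_, ?_⟩
  · rw [← Finset.sum_div, div_self hZ0.ne']
  · intro a
    refine hratio a (a - 1) ((abs_cyclicNorm_sub_le _ _).trans ?_)
    rwa [sub_sub_cancel_left, cyclicNorm_neg]
  · intro a
    refine hratio a (a + 1) ((abs_cyclicNorm_sub_le _ _).trans ?_)
    rwa [add_sub_cancel_left]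
  · intro s hs hsp
    have hpt : ∀ a : ZMod N, f a / Z * (cyclicNorm a / K : ℝ) ^ s
        ≤ (2 * p) ^ p / Z * Real.exp (-(cyclicNorm a * (1 / (2 * K)))) := by
      intro a
      set x : ℝ := cyclicNorm a / K with hx
      have hx0 : 0 ≤ x := by positivity
      have h1 : x ^ s ≤ (2 * p) ^ p * Real.exp (x / 2) :=
        calc x ^ s ≤ (1 + x) ^ s := Real.rpow_le_rpow hx0 (by linarith) hs
          _ ≤ (1 + x) ^ p := Real.rpow_le_rpow_of_exponent_le (by linarith) hsp
          _ ≤ _ := one_add_rpow_le_exp hp hx0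
      have h2 : Real.exp (-(cyclicNorm a * (1 / (2 * K)))) = Real.exp (-x) * Real.exp (x / 2) := by
        rw [← Real.exp_add]; congr 1; rw [hx]; field_simp; ring
      calc f a / Z * x ^ s ≤ Real.exp (-x) / Z * ((2 * p) ^ p * Real.exp (x / 2)) := by gcongr
        _ = _ := by rw [h2]; ring
    refine (Finset.sum_le_sum fun a _ => hpt a).trans ?_
    rw [← Finset.mul_sum]
    have h3 := sum_exp_neg_cyclicNorm_le (N := N) (t := 1 / (2 * (K:ℝ))) (by positivity)
    have h4 : 2 * (1 + 1 / (1 / (2 * (K:ℝ)))) ≤ 6 * K := by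
      rw [one_div_one_div]; linarith
    calc (2 * p) ^ p / Z * ∑ a : ZMod N, Real.exp (-(cyclicNorm a * (1 / (2 * (K:ℝ)))))
        ≤ (2 * p) ^ p / Z * (6 * K) := by gcongr; exact h3.trans h4
      _ ≤ (2 * p) ^ p / (K * Real.exp (-1)) * (6 * K) := by gcongr
      _ = _ := by rw [Real.exp_neg]; field_simp

end CyclicKernel

section Circle

/-- The standard character of `ZMod N` is Lipschitz for the cyclic distance. -/
lemma norm_stdAddChar_sub_le {N : ℕ} [NeZero N] (x y : ZMod N) :
    ‖ZMod.stdAddChar x - ZMod.stdAddChar y‖ ≤ 2 * Real.pi * cyclicNorm (x - y) / N := by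
  have h1 : ZMod.stdAddChar x - ZMod.stdAddChar y
      = ZMod.stdAddChar y * (ZMod.stdAddChar (x - y) - 1) := by
    rw [mul_sub, ← AddChar.map_add_eq_mul, add_sub_cancel, mul_one]
  have h2 : ‖(ZMod.stdAddChar y : ℂ)‖ = 1 := by rw [ZMod.stdAddChar_apply]; exact Circle.norm_coe _
  rw [h1, norm_mul, h2, one_mul]
  set u := x - y
  have h3 : (ZMod.stdAddChar u : ℂ)
      = Complex.exp (Complex.I * ((2 * Real.pi * u.valMinAbs / N : ℝ) : ℂ)) := by
    conv_lhs => rw [← ZMod.coe_valMinAbs u, ZMod.stdAddChar_coe]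
    congr 1; push_cast; ring
  rw [h3]
  refine Real.norm_exp_I_mul_ofReal_sub_one_le.trans_eq ?_
  rw [Real.norm_eq_abs, abs_div, abs_mul, abs_of_pos (by positivity : 0 < 2 * Real.pi),
    Nat.abs_cast, cyclicNorm, Nat.cast_natAbs, Int.cast_abs]

lemma stdAddChar_half {N M : ℕ} [NeZero N] (h : N = 2 * M) :
    (ZMod.stdAddChar ((M : ℤ) : ZMod N) : ℂ) = -1 := by
  have hM : (M : ℂ) ≠ 0 := by
    have := NeZero.ne N
    exact_mod_cast (by omega : M ≠ 0)
  rw [ZMod.stdAddChar_coe, ← Complex.exp_pi_mul_I]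
  congr 1
  rw [h]; push_cast; field_simp

end Circle

section LebesgueSpace

open MeasureTheory

lemma LpSpace_norm_nonneg {p : ℝ} (f : LpSpace p) : 0 ≤ ‖f‖ := by
  rw [Lp.norm_def]
  exact ENNReal.toReal_nonneg

lemma norm_rpow_eq_integral {p : ℝ} (hp : 0 < p) (f : LpSpace p) :
    ‖f‖ ^ p = ∫ ω, |f ω| ^ p := by
  have h0 : ENNReal.ofReal p ≠ 0 := by simpa using hp
  rw [Lp.norm_def, (Lp.memLp f).eLpNorm_eq_integral_rpow_norm h0 ENNReal.ofReal_ne_top,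
    ENNReal.toReal_ofReal hp.le, ENNReal.toReal_ofReal (by positivity), Real.rpow_inv_rpow _ hp.ne']
  · rfl
  · positivity

lemma integrable_abs_rpow {p : ℝ} (hp : 0 < p) (f : LpSpace p) :
    Integrable (fun ω => |f ω| ^ p) := by
  have h0 : ENNReal.ofReal p ≠ 0 := by simpa using hp
  have := (Lp.memLp f).integrable_norm_rpow h0 ENNReal.ofReal_ne_top
  rwa [ENNReal.toReal_ofReal hp.le] at this

lemma integrable_abs_sub_rpow {p : ℝ} (hp : 0 < p) (f g : LpSpace p) :
    Integrable (fun ω => |f ω - g ω| ^ p) := by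
  refine (integrable_abs_rpow hp (f - g)).congr ?_
  filter_upwards [Lp.coeFn_sub f g] with ω hω
  rw [hω, Pi.sub_apply]

lemma norm_sub_rpow_eq_integral {p : ℝ} (hp : 0 < p) (f g : LpSpace p) :
    ‖f - g‖ ^ p = ∫ ω, |f ω - g ω| ^ p := by
  rw [norm_rpow_eq_integral hp]
  refine integral_congr_ae ?_
  filter_upwards [Lp.coeFn_sub f g] with ω hω
  rw [hω, Pi.sub_apply]

/-- A linear inequality between the numbers `|F x - F y| ^ p`, valid for all real functions `F` on
a finite set, is valid for `‖f x - f y‖ ^ p` whenever `f` takes values in `L_p`. -/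
lemma sum_norm_sub_rpow_le {p : ℝ} (hp : 0 < p) {G I J : Type*} [Fintype I] [Fintype J]
    {a b : I → G} {a' b' : J → G} {c : I → ℝ} {d : J → ℝ}
    (h : ∀ F : G → ℝ, ∑ i, c i * |F (a i) - F (b i)| ^ p
      ≤ ∑ j, d j * |F (a' j) - F (b' j)| ^ p) (f : G → LpSpace p) :
    ∑ i, c i * ‖f (a i) - f (b i)‖ ^ p ≤ ∑ j, d j * ‖f (a' j) - f (b' j)‖ ^ p := by
  simp only [norm_sub_rpow_eq_integral hp, ← integral_const_mul]
  rw [← integral_finsetSum _ fun i _ => (integrable_abs_sub_rpow hp _ _).const_mul _,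
    ← integral_finsetSum _ fun i _ => (integrable_abs_sub_rpow hp _ _).const_mul _]
  exact integral_mono
    (integrable_finsetSum _ fun i _ => (integrable_abs_sub_rpow hp _ _).const_mul _)
    (integrable_finsetSum _ fun i _ => (integrable_abs_sub_rpow hp _ _).const_mul _)
    fun ω => h fun x => f x ω

/-- The metric `X_p` inequality for functions with values in `L_p`. -/
lemma exists_metric_Xp_inequality_LpSpace {p : ℝ} (hp : 2 < p) : ∃ C : ℝ, 0 < C ∧
    ∀ (n M : ℕ) (H : Type) [Fintype H] [AddCommGroup H] (w : H → ℝ) (e : H) (κ δ : ℝ),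
    (∀ a, 0 < w a) → ∑ a, w a = 1 → κ ≤ 1 → (∀ a, |w (a - e) / w a - 1| ≤ κ) →
    (∀ a, |w (a + e) / w a - 1| ≤ κ) → 0 ≤ δ → δ ≤ 1 → (M * κ) ^ 2 * δ ≤ 4 →
    M * (κ ^ 2 * 2 ^ n) ≤ 1 → ∀ f : (Fin n → H) → LpSpace p,
    ∑ x : Fin n → H, ∑ ξ : Fin n → SignType, prodWeight (signWeight δ) ξ *
        ‖f (x + (2 * M) • signStep e ξ) - f x‖ ^ p
      ≤ C * (∑ x : Fin n → H, ∑ u, prodWeight w u * ‖f (x + u) - f x‖ ^ p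
        + δ * (M * κ) ^ p * ∑ x : Fin n → H, ∑ j, ∑ u,
          prodWeight w u * ‖f (x + u) - f (x + Function.update u j 0)‖ ^ p) := by
  obtain ⟨C, hC, hXp⟩ := exists_metric_Xp_inequality hp
  refine ⟨C, hC, ?_⟩
  intro n M H _ _ w e κ δ hw h1 hκ hm hpl hδ0 hδ1 hMδ hMn f
  have key := sum_norm_sub_rpow_le (p := p) (by linarith) (G := Fin n → H)
    (I := (Fin n → H) × (Fin n → SignType))
    (J := ((Fin n → H) × (Fin n → H)) ⊕ ((Fin n → H) × Fin n × (Fin n → H)))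
    (a := fun i => i.1 + (2 * M) • signStep e i.2) (b := fun i => i.1)
    (c := fun i => prodWeight (signWeight δ) i.2)
    (a' := Sum.elim (fun i => i.1 + i.2) fun i => i.1 + i.2.2)
    (b' := Sum.elim (fun i => i.1) fun i => i.1 + Function.update i.2.2 i.2.1 0)
    (d := Sum.elim (fun i => C * prodWeight w i.2)
      fun i => C * (δ * (M * κ) ^ p) * prodWeight w i.2.2)
  simp only [Fintype.sum_prod_type, Fintype.sum_sum_type, Sum.elim_inl, Sum.elim_inr, mul_assoc C,
    mul_assoc (δ * (M * κ) ^ p), ← Finset.mul_sum, ← mul_add] at key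
  exact key (hXp n M H w e κ δ hw h1 hκ hm hpl hδ0 hδ1 hMδ hMn) f

/-- The simple function taking the value `v i` on `[i, i + 1)`. -/
noncomputable def stepFunction {d : ℕ} (v : Fin d → ℝ) (ω : ℝ) : ℝ :=
  ∑ i : Fin d, (Set.Ico (i : ℝ) (i + 1)).indicator (fun _ => v i) ω

lemma abs_stepFunction_rpow {d : ℕ} (v : Fin d → ℝ) {q : ℝ} (hq : 0 < q) (ω : ℝ) :
    |stepFunction v ω| ^ q = ∑ i : Fin d, (Set.Ico (i : ℝ) (i + 1)).indicator
      (fun _ => |v i| ^ q) ω := by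
  unfold stepFunction
  by_cases h : ∃ i : Fin d, ω ∈ Set.Ico (i : ℝ) (i + 1)
  · obtain ⟨i, hi⟩ := h
    have hne : ∀ j : Fin d, j ≠ i → ω ∉ Set.Ico (j : ℝ) (j + 1) := by
      intro j hj hω
      refine hj (Fin.ext ?_)
      have h1 : (j : ℝ) < i + 1 := hω.1.trans_lt hi.2
      have h2 : (i : ℝ) < j + 1 := hi.1.trans_lt hω.2
      norm_cast at h1 h2
      omega
    rw [Finset.sum_eq_single_of_mem i (Finset.mem_univ _)
        fun j _ hj => Set.indicator_of_notMem (hne j hj) _,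
      Finset.sum_eq_single_of_mem i (Finset.mem_univ _)
        fun j _ hj => Set.indicator_of_notMem (hne j hj) _,
      Set.indicator_of_mem hi, Set.indicator_of_mem hi]
  · push Not at h
    rw [Finset.sum_eq_zero fun i _ => Set.indicator_of_notMem (h i) _,
      Finset.sum_eq_zero fun i _ => Set.indicator_of_notMem (h i) _, abs_zero,
      Real.zero_rpow hq.ne']

lemma memLp_stepFunction {d : ℕ} (v : Fin d → ℝ) (q : ENNReal) :
    MemLp (stepFunction v) q (volume : Measure ℝ) := by
  refine memLp_finsetSum _ fun i _ => memLp_indicator_const q measurableSet_Ico (v i) (Or.inr ?_)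
  rw [Real.volume_Ico]
  exact ENNReal.ofReal_ne_top

/-- `L_q` contains isometric copies of all finite-dimensional `ℓ_q` spaces. -/
lemma exists_lq_embedding {q : ℝ} (hq : 0 < q) (d : ℕ) : ∃ J : (Fin d → ℝ) → LpSpace q,
    ∀ v v', ‖J v - J v'‖ ^ q = ∑ i, |v i - v' i| ^ q := by
  refine ⟨fun v => (memLp_stepFunction v (ENNReal.ofReal q)).toLp _, fun v v' => ?_⟩
  rw [← MemLp.toLp_sub, norm_rpow_eq_integral hq]
  have h1 : ∀ᵐ ω : ℝ, |((memLp_stepFunction v (ENNReal.ofReal q)).sub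
      (memLp_stepFunction v' (ENNReal.ofReal q))).toLp _ ω| ^ q
      = ∑ i : Fin d, (Set.Ico (i : ℝ) (i + 1)).indicator (fun _ => |v i - v' i| ^ q) ω := by
    filter_upwards [MemLp.coeFn_toLp ((memLp_stepFunction v (ENNReal.ofReal q)).sub
      (memLp_stepFunction v' (ENNReal.ofReal q)))] with ω hω
    rw [hω, ← abs_stepFunction_rpow (fun i => v i - v' i) hq, Pi.sub_apply]
    congr 2
    rw [stepFunction, stepFunction, stepFunction, ← Finset.sum_sub_distrib]
    exact Finset.sum_congr rfl fun i _ => by simp only [Set.indicator]; split_ifs <;> simp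
  rw [integral_congr_ae h1, integral_finsetSum]
  · refine Finset.sum_congr rfl fun i _ => ?_
    rw [integral_indicator measurableSet_Ico]
    simp
  · intro i _
    exact (integrable_indicator_iff measurableSet_Ico).mpr
      (integrableOn_const (by simp))

end LebesgueSpace

section Torus

lemma one_le_two_mul_abs_re_rpow_add {z : ℂ} (hz : ‖z‖ = 1) {q : ℝ} (hq : 0 < q) :
    1 ≤ |2 * z.re| ^ q + |2 * z.im| ^ q := by
  have h1 : z.re ^ 2 + z.im ^ 2 = 1 := by
    rw [← Complex.sq_norm_sub_sq_re z, hz]; ring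
  by_cases h : 1 ≤ |2 * z.re|
  · have := Real.one_le_rpow h hq.le
    linarith [Real.rpow_nonneg (abs_nonneg (2 * z.im)) q]
  · have h2 : 1 ≤ |2 * z.im| := by
      push Not at h
      have h3 : (2 * z.re) ^ 2 < 1 := (sq_lt_one_iff_abs_lt_one _).mpr h
      rw [← one_le_sq_iff_one_le_abs]
      nlinarith
    have := Real.one_le_rpow h2 hq.le
    linarith [Real.rpow_nonneg (abs_nonneg (2 * z.re)) q]

lemma norm_stdAddChar {N : ℕ} [NeZero N] (x : ZMod N) : ‖(ZMod.stdAddChar x : ℂ)‖ = 1 := by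
  rw [ZMod.stdAddChar_apply]
  exact Circle.norm_coe _

lemma stdAddChar_add_half_zsmul {N M : ℕ} [NeZero N] (h : N = 2 * M) (x : ZMod N) {s : SignType}
    (hs : s ≠ 0) :
    (ZMod.stdAddChar (x + M • ((s : ℤ) • (1 : ZMod N))) : ℂ) = -ZMod.stdAddChar x := by
  have h1 := stdAddChar_half (N := N) h
  rw [AddChar.map_add_eq_mul]
  cases s with
  | zero => exact absurd rfl hs
  | neg =>
    have h2 : M • (((SignType.neg : SignType) : ℤ) • (1 : ZMod N)) = -((M : ℤ) : ZMod N) := by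
      simp
    rw [h2, AddChar.map_neg_eq_inv, h1]
    norm_num
  | pos =>
    have h2 : M • (((SignType.pos : SignType) : ℤ) • (1 : ZMod N)) = ((M : ℤ) : ZMod N) := by
      simp
    rw [h2, h1]
    ring

/-- A map of a discrete torus into `L_q` with Lipschitz coordinates, for which half-period
translations are long. -/
lemma exists_torus_map {q : ℝ} (hq : 1 ≤ q) (n m K : ℕ) [NeZero (4 * m * K)] :
    ∃ T : (Fin n → ZMod (4 * m * K)) → LpSpace q,
      (∀ x y, ‖T x - T y‖ ^ q ≤ 4 ^ q * ∑ j, (cyclicNorm (x j - y j) / K : ℝ) ^ q) ∧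
      ∀ x (ξ : Fin n → SignType), (m : ℝ) ^ q * ∑ j, (if ξ j = 0 then 0 else 1 : ℝ)
        ≤ ‖T (x + (2 * (m * K)) • signStep 1 ξ) - T x‖ ^ q := by
  have hq0 : 0 < q := by linarith
  have hmK : m ≠ 0 ∧ K ≠ 0 := by
    have := NeZero.ne (4 * m * K)
    constructor <;> rintro rfl <;> simp at this
  have hm : (0:ℝ) < m := by exact_mod_cast Nat.pos_of_ne_zero hmK.1
  have hK : (0:ℝ) < K := by exact_mod_cast Nat.pos_of_ne_zero hmK.2
  obtain ⟨J, hJ⟩ := exists_lq_embedding hq0 (n + n)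
  set χ : ZMod (4 * m * K) → ℂ := fun a => ZMod.stdAddChar a with hχ
  set T : (Fin n → ZMod (4 * m * K)) → LpSpace q := fun x =>
    J (Fin.append (fun j => m * (χ (x j)).re) fun j => m * (χ (x j)).im) with hT
  have hTn : ∀ x y, ‖T x - T y‖ ^ q = ∑ j, ((m * |(χ (x j) - χ (y j)).re|) ^ q
      + (m * |(χ (x j) - χ (y j)).im|) ^ q) := by
    intro x y
    rw [hJ, Fin.sum_univ_add, Finset.sum_add_distrib]
    simp only [Fin.append_left, Fin.append_right, ← mul_sub, abs_mul, Nat.abs_cast,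
      Complex.sub_re, Complex.sub_im]
  refine ⟨T, fun x y => ?_, fun x ξ => ?_⟩
  · rw [hTn, Finset.mul_sum]
    refine Finset.sum_le_sum fun j _ => ?_
    set r : ℝ := cyclicNorm (x j - y j) / K with hr
    have hr0 : 0 ≤ r := by positivity
    have h1 : m * ‖χ (x j) - χ (y j)‖ ≤ 2 * r := by
      have h2 := mul_le_mul_of_nonneg_left (norm_stdAddChar_sub_le (x j) (y j)) hm.le
      refine h2.trans ?_
      have h3 : (m : ℝ) * (2 * Real.pi * cyclicNorm (x j - y j) / ((4 * m * K : ℕ) : ℝ))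
          = Real.pi / 2 * r := by
        rw [hr]; push_cast; field_simp; ring
      rw [h3]
      gcongr
      linarith [Real.pi_le_four]
    have h4 : ∀ t : ℝ, |t| ≤ ‖χ (x j) - χ (y j)‖ → (m * |t|) ^ q ≤ 2 ^ q * r ^ q := by
      intro t ht
      rw [← Real.mul_rpow (by norm_num) hr0]
      exact Real.rpow_le_rpow (by positivity)
        ((mul_le_mul_of_nonneg_left ht hm.le).trans h1) hq0.le
    have h5 := h4 _ (Complex.abs_re_le_norm (χ (x j) - χ (y j)))
    have h6 := h4 _ (Complex.abs_im_le_norm (χ (x j) - χ (y j)))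
    have h7 : (2:ℝ) * 2 ^ q ≤ 4 ^ q := by
      have : (4:ℝ) ^ q = 2 ^ q * 2 ^ q := by
        rw [← Real.mul_rpow (by norm_num) (by norm_num)]; norm_num
      rw [this]
      gcongr
      simpa using Real.rpow_le_rpow_of_exponent_le (by norm_num : (1:ℝ) ≤ 2) hq
    have h8 := mul_le_mul_of_nonneg_right h7 (Real.rpow_nonneg hr0 q)
    linarith
  · rw [hTn, Finset.mul_sum]
    refine Finset.sum_le_sum fun j _ => ?_
    split_ifs with h0
    · rw [mul_zero]; positivity
    · have h1 : χ ((x + (2 * (m * K)) • signStep 1 ξ : Fin n → ZMod (4 * m * K)) j) = -χ (x j) :=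
        stdAddChar_add_half_zsmul (by ring) (x j) h0
      have h2 : -χ (x j) - χ (x j) = -(2 * χ (x j)) := by ring
      rw [h1, h2, Complex.neg_re, Complex.neg_im, abs_neg, abs_neg,
        Real.mul_rpow hm.le (abs_nonneg _), Real.mul_rpow hm.le (abs_nonneg _), ← mul_add]
      gcongr
      have := one_le_two_mul_abs_re_rpow_add (norm_stdAddChar (x j)) hq0
      simpa [hχ] using this

end Torus

/-- The metric `X_p` inequality restricts `θ`-Hölder embeddings of `L_q` into `L_p`. -/
lemma exists_holder_embedding_constraint {p : ℝ} (hp : 2 < p) : ∃ D : ℝ, 0 < D ∧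
    ∀ q θ L : ℝ, 1 ≤ q → 0 < θ → θ ≤ 1 → 1 ≤ θ * p / q → 0 ≤ L →
    ∀ ψ : LpSpace q → LpSpace p,
    (∀ x y, ‖x - y‖ ^ θ ≤ ‖ψ x - ψ y‖ ∧ ‖ψ x - ψ y‖ ≤ L * ‖x - y‖ ^ θ) →
    ∀ m n : ℕ, 0 < m → 0 < n →
    ((m : ℝ) ^ (q - 2) * n) ^ (θ * p / q) ≤
      D * L ^ p * ((n : ℝ) ^ (θ * p / q) + (m : ℝ) ^ (p - 2) * n) := by
  obtain ⟨C, hC, hXp⟩ := exists_metric_Xp_inequality_LpSpace hp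
  obtain ⟨B, hB, hw⟩ := exists_cyclic_weight (show 1 ≤ p by linarith)
  refine ⟨C * 4 ^ p * B * 2 ^ p, by positivity, ?_⟩
  intro q θ L hq hθ0 hθ1 hs1 hL ψ hψ m n hm hn
  have hq0 : 0 < q := by linarith
  have hp0 : 0 < p := by linarith
  set s := θ * p / q with hs
  have hs0 : 0 < s := by linarith
  have hqs : q * s = θ * p := by rw [hs]; field_simp
  have hqsp : q * s ≤ p := by rw [hqs]; nlinarith
  have hm1 : (1:ℝ) ≤ m := by exact_mod_cast hm
  have hn0 : (0:ℝ) < n := by exact_mod_cast hn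
  set K := 4 * m * 2 ^ n with hKdef
  have hK : 0 < K := by positivity
  have hKR : (K : ℝ) = 4 * m * 2 ^ n := by rw [hKdef]; push_cast; rfl
  have hK2 : (2:ℝ) ≤ K := by
    have : 2 ≤ K := by
      have : 0 < m * 2 ^ n := by positivity
      rw [hKdef, mul_assoc]; omega
    exact_mod_cast this
  have hK0 : (0:ℝ) < K := by linarith
  have : NeZero (4 * m * K) := ⟨by positivity⟩
  obtain ⟨w, hw0, hw1, hwm, hwp, hmom⟩ := hw (4 * m * K) K hK
    (Nat.le_mul_of_pos_left K (by positivity))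
  obtain ⟨T, hTu, hTl⟩ := exists_torus_map hq n m K
  set f := fun x => ψ (T x) with hf
  have hup : ∀ x y : Fin n → ZMod (4 * m * K), ‖f x - f y‖ ^ p
      ≤ L ^ p * 4 ^ p * (∑ j, (cyclicNorm (x j - y j) / K : ℝ) ^ q) ^ s := by
    intro x y
    have hsum : 0 ≤ ∑ j, (cyclicNorm (x j - y j) / K : ℝ) ^ q :=
      Finset.sum_nonneg fun j _ => by positivity
    calc ‖f x - f y‖ ^ p ≤ (L * ‖T x - T y‖ ^ θ) ^ p :=
          Real.rpow_le_rpow (LpSpace_norm_nonneg _) (hψ _ _).2 hp0.le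
      _ = L ^ p * (‖T x - T y‖ ^ q) ^ s := by
          rw [Real.mul_rpow hL (Real.rpow_nonneg (LpSpace_norm_nonneg _) _),
            ← Real.rpow_mul (LpSpace_norm_nonneg _),
            ← Real.rpow_mul (LpSpace_norm_nonneg _), hqs]
      _ ≤ L ^ p * (4 ^ q * ∑ j, (cyclicNorm (x j - y j) / K : ℝ) ^ q) ^ s := by
          gcongr
          · exact Real.rpow_nonneg (LpSpace_norm_nonneg _) _
          · exact hTu x y
      _ = L ^ p * 4 ^ (q * s) * (∑ j, (cyclicNorm (x j - y j) / K : ℝ) ^ q) ^ s := by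
          rw [Real.mul_rpow (by positivity) hsum, ← Real.rpow_mul (by norm_num)]; ring
      _ ≤ _ := by
          gcongr
          norm_num
  have hlow : ∀ (x : Fin n → ZMod (4 * m * K)) (ξ : Fin n → SignType),
      ((m : ℝ) ^ q * ∑ j, (if ξ j = 0 then 0 else 1 : ℝ)) ^ s
        ≤ ‖f (x + (2 * (m * K)) • signStep 1 ξ) - f x‖ ^ p := by
    intro x ξ
    have h0 : 0 ≤ ∑ j, (if ξ j = 0 then 0 else 1 : ℝ) :=
      Finset.sum_nonneg fun j _ => by split_ifs <;> norm_num
    refine (Real.rpow_le_rpow (by positivity) (hTl x ξ) hs0.le).trans ?_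
    rw [← Real.rpow_mul (LpSpace_norm_nonneg _), hqs, Real.rpow_mul (LpSpace_norm_nonneg _)]
    exact Real.rpow_le_rpow (Real.rpow_nonneg (LpSpace_norm_nonneg _) _) (hψ _ _).1 hp0.le
  set δ : ℝ := ((m : ℝ) ^ 2)⁻¹ with hδ
  have hδ0 : 0 ≤ δ := by positivity
  have hδ1 : δ ≤ 1 := inv_le_one_of_one_le₀ (one_le_pow₀ hm1)
  have hMκ : ((m * K : ℕ) : ℝ) * (2 / K) = 2 * m := by push_cast; field_simp
  have key := hXp n (m * K) (ZMod (4 * m * K)) w 1 (2 / K) δ hw0 hw1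
    ((div_le_one hK0).mpr hK2) hwm hwp hδ0 hδ1
    (by rw [hMκ, hδ]; refine le_of_eq ?_; field_simp; norm_num)
    (by
      have : ((m * K : ℕ) : ℝ) * ((2 / K) ^ 2 * 2 ^ n) = (4 * m * 2 ^ n) / K := by
        push_cast; field_simp; norm_num
      rw [this, hKR, div_self (by positivity)]) f
  rw [hMκ] at key
  have hW : ∀ u : Fin n → ZMod (4 * m * K), 0 ≤ prodWeight w u := prodWeight_nonneg fun a => (hw0 a).le
  have hmom' := hmom (q * s) (by positivity) hqsp
  have hcard : (0:ℝ) < Fintype.card (Fin n → ZMod (4 * m * K)) := by exact_mod_cast Fintype.card_pos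
  set Q : ℝ := L ^ p * 4 ^ p * B with hQ
  have hQ0 : 0 ≤ Q := by positivity
  have hV : ∀ x : Fin n → ZMod (4 * m * K), ∑ u, prodWeight w u * ‖f (x + u) - f x‖ ^ p ≤ Q * (n : ℝ) ^ s := by
    intro x
    calc ∑ u, prodWeight w u * ‖f (x + u) - f x‖ ^ p
        ≤ ∑ u : Fin n → ZMod (4 * m * K), prodWeight w u * (L ^ p * 4 ^ p * ((n : ℝ) ^ (s - 1) *
          ∑ j, (cyclicNorm (u j) / K : ℝ) ^ (q * s))) := by
          refine Finset.sum_le_sum fun u _ => mul_le_mul_of_nonneg_left ?_ (hW u)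
          refine (hup _ _).trans ?_
          simp only [Pi.add_apply, add_sub_cancel_left]
          gcongr
          refine (Real.rpow_sum_le_const_mul_sum_rpow_of_nonneg _ hs1
            fun j _ => by positivity).trans_eq ?_
          rw [Finset.card_univ, Fintype.card_fin]
          congr 1
          exact Finset.sum_congr rfl fun j _ => (Real.rpow_mul (by positivity) _ _).symm
      _ = L ^ p * 4 ^ p * (n : ℝ) ^ (s - 1) *
          ∑ j : Fin n, ∑ u : Fin n → ZMod (4 * m * K), prodWeight w u * (cyclicNorm (u j) / K : ℝ) ^ (q * s) := by
          rw [Finset.sum_comm, Finset.mul_sum]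
          refine Finset.sum_congr rfl fun u _ => ?_
          rw [← Finset.mul_sum]; ring
      _ ≤ L ^ p * 4 ^ p * (n : ℝ) ^ (s - 1) * ∑ j : Fin n, B := by
          gcongr with j _
          exact (sum_prodWeight_mul_apply hw1 j fun a => (cyclicNorm a / K : ℝ) ^ (q * s)).trans_le
            hmom'
      _ = Q * (n : ℝ) ^ s := by
          rw [Finset.sum_const, Finset.card_univ, Fintype.card_fin, nsmul_eq_mul,
            Real.rpow_sub_one hn0.ne']
          field_simp
          ring
  have hU : ∀ (x : Fin n → ZMod (4 * m * K)) (j : Fin n),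
      ∑ u, prodWeight w u * ‖f (x + u) - f (x + Function.update u j 0)‖ ^ p ≤ Q := by
    intro x j
    calc ∑ u, prodWeight w u * ‖f (x + u) - f (x + Function.update u j 0)‖ ^ p
        ≤ ∑ u : Fin n → ZMod (4 * m * K), prodWeight w u * (L ^ p * 4 ^ p * (cyclicNorm (u j) / K : ℝ) ^ (q * s)) := by
          refine Finset.sum_le_sum fun u _ => mul_le_mul_of_nonneg_left ?_ (hW u)
          refine (hup _ _).trans_eq ?_
          rw [Finset.sum_eq_single_of_mem j (Finset.mem_univ j), Real.rpow_mul (by positivity)]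
          · simp
          · intro i _ hij
            simp [Function.update_of_ne hij, cyclicNorm, Real.zero_rpow hq0.ne']
      _ = L ^ p * 4 ^ p * ∑ u : Fin n → ZMod (4 * m * K), prodWeight w u * (cyclicNorm (u j) / K : ℝ) ^ (q * s) := by
          rw [Finset.mul_sum]; exact Finset.sum_congr rfl fun u _ => by ring
      _ ≤ L ^ p * 4 ^ p * B := by
          gcongr
          exact (sum_prodWeight_mul_apply hw1 j fun a => (cyclicNorm a / K : ℝ) ^ (q * s)).trans_le
            hmom'
  have hlhs : ∀ x : Fin n → ZMod (4 * m * K), ((m : ℝ) ^ (q - 2) * n) ^ s ≤ ∑ ξ : Fin n → SignType,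
      prodWeight (signWeight δ) ξ * ‖f (x + (2 * (m * K)) • signStep 1 ξ) - f x‖ ^ p := by
    intro x
    have hS := prodWeight_nonneg (ι := Fin n) (signWeight_nonneg hδ0 hδ1)
    refine le_trans ?_ (Finset.sum_le_sum fun ξ _ => mul_le_mul_of_nonneg_left (hlow x ξ) (hS ξ))
    have h0 : ∀ ξ : Fin n → SignType, 0 ≤ (m : ℝ) ^ q * ∑ j, (if ξ j = 0 then 0 else 1 : ℝ) :=
      fun ξ => mul_nonneg (by positivity)
        (Finset.sum_nonneg fun j _ => by split_ifs <;> norm_num)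
    refine le_trans (le_of_eq ?_) (Real.rpow_arith_mean_le_arith_mean_rpow univ
      (prodWeight (signWeight δ)) _ (fun ξ _ => hS ξ) (sum_prodWeight (sum_signWeight δ))
      (fun ξ _ => h0 ξ) hs1)
    congr 1
    have h1 : ∀ j : Fin n, ∑ ξ : Fin n → SignType,
        prodWeight (signWeight δ) ξ * (if ξ j = 0 then 0 else 1 : ℝ) = δ := by
      intro j
      rw [sum_prodWeight_mul_apply (sum_signWeight δ) j fun a => (if a = 0 then 0 else 1 : ℝ),
        sum_signWeight_mul]
      simp
    calc (m : ℝ) ^ (q - 2) * n = (m : ℝ) ^ q * ∑ j : Fin n, δ := by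
          rw [Finset.sum_const, Finset.card_univ, Fintype.card_fin, nsmul_eq_mul,
            Real.rpow_sub (by linarith), Real.rpow_two, hδ]
          ring
      _ = (m : ℝ) ^ q * ∑ j : Fin n, ∑ ξ : Fin n → SignType,
          prodWeight (signWeight δ) ξ * (if ξ j = 0 then 0 else 1 : ℝ) := by simp only [h1]
      _ = _ := by
          rw [Finset.sum_comm, Finset.mul_sum]
          refine Finset.sum_congr rfl fun ξ _ => ?_
          rw [← Finset.mul_sum]; ring
  have hδm : δ * (2 * m) ^ p = 2 ^ p * (m : ℝ) ^ (p - 2) := by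
    rw [Real.mul_rpow (by norm_num) (by linarith), Real.rpow_sub (by linarith), Real.rpow_two, hδ]
    ring
  have h2p : (1:ℝ) ≤ 2 ^ p := Real.one_le_rpow (by norm_num) hp0.le
  have hchain : Fintype.card (Fin n → ZMod (4 * m * K)) * ((m : ℝ) ^ (q - 2) * n) ^ s ≤ Fintype.card (Fin n → ZMod (4 * m * K)) *
      (C * (Q * (n : ℝ) ^ s + δ * (2 * m) ^ p * (n * Q))) := by
    calc Fintype.card (Fin n → ZMod (4 * m * K)) * ((m : ℝ) ^ (q - 2) * n) ^ s
        = ∑ x : Fin n → ZMod (4 * m * K), ((m : ℝ) ^ (q - 2) * n) ^ s := by simp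
      _ ≤ _ := Finset.sum_le_sum fun x _ => hlhs x
      _ ≤ _ := key
      _ ≤ C * (∑ x : Fin n → ZMod (4 * m * K), Q * (n : ℝ) ^ s + δ * (2 * m) ^ p * ∑ x : Fin n → ZMod (4 * m * K), ∑ j : Fin n, Q) := by
          gcongr with x _ x _ j _
          · exact hV x
          · exact hU x j
      _ = _ := by
          simp only [Finset.sum_const, Finset.card_univ, Fintype.card_fin, nsmul_eq_mul]
          ring
  refine (le_of_mul_le_mul_left hchain hcard).trans ?_
  rw [hδm]
  have h3 : 0 ≤ C * Q * (n : ℝ) ^ s := by positivity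
  have h4 := mul_le_mul_of_nonneg_left h2p h3
  rw [hQ] at h4 ⊢
  linarith

lemma exists_pos_nat_lt_rpow {r : ℝ} (hr : 0 < r) (b : ℝ) : ∃ n : ℕ, 0 < n ∧ b < (n : ℝ) ^ r := by
  have h := (tendsto_rpow_atTop hr).comp tendsto_natCast_atTop_atTop
  obtain ⟨n, hn, hb⟩ := ((Filter.eventually_gt_atTop 0).and (h.eventually_gt_atTop b)).exists
  exact ⟨n, hn, hb⟩

/-- For `2 < q < p` and `θ > q / p`, the `θ`-snowflake of `L_q` does not embed into `L_p`. -/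
lemma not_exists_holder_embedding {p q θ L : ℝ} (hp : 2 < p) (hq : 2 < q) (hθ0 : 0 < θ)
    (hθ1 : θ ≤ 1) (hθ : q < θ * p) (hL : 1 ≤ L) (ψ : LpSpace q → LpSpace p)
    (hψ : ∀ x y, ‖x - y‖ ^ θ ≤ ‖ψ x - ψ y‖ ∧ ‖ψ x - ψ y‖ ≤ L * ‖x - y‖ ^ θ) : False := by
  obtain ⟨D, hD, h⟩ := exists_holder_embedding_constraint hp
  have hs : 1 < θ * p / q := by rwa [one_lt_div (by linarith)]
  have key := h q θ L (by linarith) hθ0 hθ1 hs.le (by linarith) ψ hψ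
  set s := θ * p / q
  have hD' : 0 < D * L ^ p := by positivity
  set D' := D * L ^ p
  obtain ⟨m, hm, hmD⟩ := exists_pos_nat_lt_rpow (r := (q - 2) * s)
    (mul_pos (by linarith) (by linarith)) (2 * D')
  obtain ⟨n, hn, hnm⟩ := exists_pos_nat_lt_rpow (r := s - 1) (by linarith) ((m : ℝ) ^ (p - 2))
  have hn0 : (0:ℝ) < n := by exact_mod_cast hn
  have h1 := key m n hm hn
  have h2 : (n : ℝ) ^ s = (n : ℝ) ^ (s - 1) * n := by
    rw [Real.rpow_sub_one hn0.ne']; field_simp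
  rw [Real.mul_rpow (by positivity) hn0.le, ← Real.rpow_mul (by positivity)] at h1
  have h3 : 2 * D' * (n : ℝ) ^ s < (m : ℝ) ^ ((q - 2) * s) * (n : ℝ) ^ s :=
    mul_lt_mul_of_pos_right hmD (by positivity)
  have h4 : D' * ((m : ℝ) ^ (p - 2) * n) < D' * (n : ℝ) ^ s := by
    rw [h2]
    gcongr
  linarith

lemma one_le_holder_bound_of_mul_le {p q θ : ℝ} (hp : 0 < p) (hq : 0 < q) (hθ : θ ≤ 1)
    (hθp : θ * p ≤ q) {n k : ℕ} (hk : 1 ≤ k) (hkn : k ≤ n) :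
    1 ≤ (n : ℝ) ^ ((1 - θ) / 2) *
      ((k : ℝ) + (k : ℝ) ^ (p / 2) * (n : ℝ) ^ (p * (θ / q - 1 / 2))) ^ (1 / p) *
      (k : ℝ) ^ (θ * (1 / 2 - 1 / q) - 1 / 2) := by
  have hk1 : (1:ℝ) ≤ k := by exact_mod_cast hk
  have hk0 : (0:ℝ) < k := by linarith
  have hkn' : (k : ℝ) ≤ n := by exact_mod_cast hkn
  have h1 : (k : ℝ) ^ ((1 - θ) / 2) ≤ (n : ℝ) ^ ((1 - θ) / 2) :=
    Real.rpow_le_rpow hk0.le hkn' (by linarith)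
  have h2 : (k : ℝ) ^ (1 / p)
      ≤ ((k : ℝ) + (k : ℝ) ^ (p / 2) * (n : ℝ) ^ (p * (θ / q - 1 / 2))) ^ (1 / p) := by
    refine Real.rpow_le_rpow hk0.le ?_ (by positivity)
    have : 0 ≤ (k : ℝ) ^ (p / 2) * (n : ℝ) ^ (p * (θ / q - 1 / 2)) := by positivity
    linarith
  have h3 : 0 ≤ 1 / p - θ / q := by
    rw [sub_nonneg, div_le_div_iff₀ hq hp]; linarith
  calc (1:ℝ) ≤ (k : ℝ) ^ (1 / p - θ / q) := Real.one_le_rpow hk1 h3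
    _ = (k : ℝ) ^ ((1 - θ) / 2) * (k : ℝ) ^ (1 / p)
          * (k : ℝ) ^ (θ * (1 / 2 - 1 / q) - 1 / 2) := by
        rw [← Real.rpow_add hk0, ← Real.rpow_add hk0]
        congr 1; ring
    _ ≤ _ := by gcongr

lemma one_le_holder_bound_two {p θ : ℝ} (hp : 0 < p) {n k : ℕ} (hk : 1 ≤ k) (hkn : k ≤ n) :
    1 ≤ (n : ℝ) ^ ((1 - θ) / 2) *
      ((k : ℝ) + (k : ℝ) ^ (p / 2) * (n : ℝ) ^ (p * (θ / 2 - 1 / 2))) ^ (1 / p) *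
      (k : ℝ) ^ (θ * (1 / 2 - 1 / 2) - 1 / 2) := by
  have hk0 : (0:ℝ) < k := by exact_mod_cast hk
  have hn0 : (0:ℝ) < n := by exact_mod_cast hk.trans hkn
  have h2 : (k : ℝ) ^ (1 / 2 : ℝ) * (n : ℝ) ^ (θ / 2 - 1 / 2)
      ≤ ((k : ℝ) + (k : ℝ) ^ (p / 2) * (n : ℝ) ^ (p * (θ / 2 - 1 / 2))) ^ (1 / p) := by
    have h3 : (k : ℝ) ^ (1 / 2 : ℝ) * (n : ℝ) ^ (θ / 2 - 1 / 2)
        = ((k : ℝ) ^ (p / 2) * (n : ℝ) ^ (p * (θ / 2 - 1 / 2))) ^ (1 / p) := by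
      rw [Real.mul_rpow (by positivity) (by positivity), ← Real.rpow_mul hk0.le,
        ← Real.rpow_mul hn0.le]
      congr 2 <;> field_simp
    rw [h3]
    refine Real.rpow_le_rpow (by positivity) ?_ (by positivity)
    linarith
  calc (1:ℝ) = (n : ℝ) ^ ((1 - θ) / 2) * ((k : ℝ) ^ (1 / 2 : ℝ) * (n : ℝ) ^ (θ / 2 - 1 / 2))
        * (k : ℝ) ^ (θ * (1 / 2 - 1 / 2) - 1 / 2) := by
        have h4 : (n : ℝ) ^ ((1 - θ) / 2) * (n : ℝ) ^ (θ / 2 - 1 / 2) = 1 := by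
          rw [← Real.rpow_add hn0, ← Real.rpow_zero (n : ℝ)]; congr 1; ring
        have h5 : (k : ℝ) ^ (1 / 2 : ℝ) * (k : ℝ) ^ (θ * (1 / 2 - 1 / 2) - 1 / 2) = 1 := by
          rw [← Real.rpow_add hk0, ← Real.rpow_zero (k : ℝ)]; congr 1; ring
        calc (1:ℝ) = ((n : ℝ) ^ ((1 - θ) / 2) * (n : ℝ) ^ (θ / 2 - 1 / 2))
              * ((k : ℝ) ^ (1 / 2 : ℝ) * (k : ℝ) ^ (θ * (1 / 2 - 1 / 2) - 1 / 2)) := by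
              rw [h4, h5, one_mul]
          _ = _ := by ring
    _ ≤ _ := by gcongr

/-- **Inequality (1.8): the constraint on Hölder embeddings of `L_q` into `L_p`.**
Let `2 ≤ q < p < ∞`. There is `C = C(p) > 0` depending only on `p` such that for every
`θ ∈ (0,1]`, `L ∈ [1,∞)` and `ψ : L_q → L_p` satisfying
`‖x-y‖_{L_q}^θ ≤ ‖ψ(x) - ψ(y)‖_{L_p} ≤ L ‖x-y‖_{L_q}^θ` for all `x, y`, one has, for every
`n ∈ ℕ` and `k ∈ [n]`,
`1 ≤ C L n^{(1-θ)/2} (k + k^{p/2} n^{p(θ/q - 1/2)})^{1/p} k^{θ(1/2 - 1/q) - 1/2}`. -/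
theorem holder_embedding_inequality (p : ℝ) (hp : 2 ≤ p) :
    ∃ C : ℝ, 0 < C ∧ ∀ q : ℝ, 2 ≤ q → q < p → ∀ θ : ℝ, 0 < θ → θ ≤ 1 →
      ∀ L : ℝ, 1 ≤ L → ∀ ψ : LpSpace q → LpSpace p,
      (∀ x y : LpSpace q,
        ‖x - y‖ ^ θ ≤ ‖ψ x - ψ y‖ ∧ ‖ψ x - ψ y‖ ≤ L * ‖x - y‖ ^ θ) →
      ∀ n : ℕ, 0 < n → ∀ k : ℕ, 1 ≤ k → k ≤ n →
      1 ≤ C * L * (n : ℝ) ^ ((1 - θ) / 2) *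
          ((k : ℝ) + (k : ℝ) ^ (p / 2) * (n : ℝ) ^ (p * (θ / q - 1 / 2))) ^ (1 / p) *
          (k : ℝ) ^ (θ * (1 / 2 - 1 / q) - 1 / 2) := by
  refine ⟨1, one_pos, fun q hq hqp θ hθ0 hθ1 L hL ψ hψ n _ k hk hkn => ?_⟩
  have hp0 : 0 < p := by linarith
  suffices h : 1 ≤ (n : ℝ) ^ ((1 - θ) / 2) *
      ((k : ℝ) + (k : ℝ) ^ (p / 2) * (n : ℝ) ^ (p * (θ / q - 1 / 2))) ^ (1 / p) *
      (k : ℝ) ^ (θ * (1 / 2 - 1 / q) - 1 / 2) by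
    rw [one_mul, mul_assoc, mul_assoc L, ← mul_assoc (_ ^ _)]
    exact one_le_mul_of_one_le_of_one_le hL h
  rcases le_or_gt (θ * p) q with hθp | hθp
  · exact one_le_holder_bound_of_mul_le hp0 (by linarith) hθ1 hθp hk hkn
  rcases hq.eq_or_lt with rfl | hq2
  · exact one_le_holder_bound_two hp0 hk hkn
  · exact (not_exists_holder_embedding (hq2.trans hqp) hq2 hθ0 hθ1 hθp hL ψ hψ).elim
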